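/- arXiv:1204.6361 — 8 statements merged into one kernel-verified Lean document; each statement's English description precedes it below -/
import Mathlib

section
/- Let t be an odd positive integer and s a non-negative integer. Let a = (t^(2^(s+1)) − 1)/2^(s+3) (an integer, by Gauss's lemma that t^(2^m) ≡ 1 mod 2^(m+2) for m ≥ 1), and let c_0, c_1, …, c_s ∈ {0,1} be the first s+1 binary digits of a (i.e., c_i is the i-th bit of a, so a ≡ Σ_{i=0}^{s} c_i·2^i (mod 2^(s+1))). Then for every integer m ≥ s+1, t^(2^m) ≡ 1 + Σ_{i=0}^{s} c_i·2^(m+2+i) (mod 2^(m+s+3)). -/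
theorem sum_range_binary_digits (a n : ℕ) :
    ∑ i ∈ Finset.range n, (a / 2 ^ i % 2) * 2 ^ i = a % 2 ^ n := by
  induction n with
  | zero => simp [Nat.mod_one]
  | succ n ih => rw [Finset.sum_range_succ, ih, Nat.mod_pow_succ, mul_comm (2 ^ n)]

theorem Odd.exists_pow_two_pow_eq {t : ℕ} (ht : Odd t) (k : ℕ) :
    ∃ a, t ^ 2 ^ (k + 1) = 1 + a * 2 ^ (k + 3) := by
  induction k with
  | zero =>
    obtain ⟨r, rfl⟩ := ht
    obtain ⟨q, hq⟩ := (Nat.even_mul_succ_self r).two_dvd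
    refine ⟨q, ?_⟩
    norm_num
    linear_combination 4 * hq
  | succ k ih =>
    obtain ⟨a, ha⟩ := ih
    refine ⟨a + a ^ 2 * 2 ^ (k + 2), ?_⟩
    rw [pow_succ 2 (k + 1), pow_mul, ha]
    ring

theorem exists_pow_two_pow_eq_of_le {t s a m : ℕ}
    (ha : t ^ 2 ^ (s + 1) = 1 + a * 2 ^ (s + 3)) (hm : s + 1 ≤ m) :
    ∃ b, b ≡ a [MOD 2 ^ (s + 1)] ∧ t ^ 2 ^ m = 1 + b * 2 ^ (m + 2) := by
  induction m, hm using Nat.le_induction with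
  | base => exact ⟨a, rfl, ha⟩
  | succ m hm ih =>
    obtain ⟨b, hb, h⟩ := ih
    refine ⟨b + b ^ 2 * 2 ^ (m + 1), ?_, ?_⟩
    · have hdvd : 2 ^ (s + 1) ∣ b ^ 2 * 2 ^ (m + 1) :=
        (pow_dvd_pow 2 (by omega)).mul_left _
      simpa using hb.add (Nat.modEq_zero_iff_dvd.mpr hdvd)
    · rw [pow_succ 2 m, pow_mul, h]
      ring

theorem binary_rep_of_odd_power (t s : ℕ) (ht : 0 < t) (hodd : Odd t)
    (m : ℕ) (hm : s + 1 ≤ m) :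
    t ^ (2 ^ m) ≡
      1 + ∑ i ∈ Finset.range (s + 1),
        ((t ^ (2 ^ (s + 1)) - 1) / 2 ^ (s + 3) / 2 ^ i % 2) * 2 ^ (m + 2 + i)
      [MOD 2 ^ (m + s + 3)] := by
  obtain ⟨a, ha⟩ := hodd.exists_pow_two_pow_eq s
  obtain ⟨b, hb, h⟩ := exists_pow_two_pow_eq_of_le ha hm
  have hdiv : (t ^ 2 ^ (s + 1) - 1) / 2 ^ (s + 3) = a := by
    rw [ha, Nat.add_sub_cancel_left, Nat.mul_div_cancel _ (by positivity)]
  have hsum : ∑ i ∈ Finset.range (s + 1), (a / 2 ^ i % 2) * 2 ^ (m + 2 + i) =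
      a % 2 ^ (s + 1) * 2 ^ (m + 2) := by
    rw [← sum_range_binary_digits, Finset.sum_mul]
    exact Finset.sum_congr rfl fun i _ => by ring
  rw [hdiv, hsum, h, show m + s + 3 = (s + 1) + (m + 2) by ring, pow_add 2 (s + 1)]
  exact ((hb.trans (Nat.mod_modEq _ _).symm).mul_right' _).add_left 1
end

section
/- Let k, m, n be non-negative integers with n ≥ k ≥ 5, m ≥ b_k, and 2^m ≥ m − b_k + ν₂(k!). Then the set S([n]_{2^m}, k) = { S(j,k) : j ∈ [n]_{2^m} } is constant modulo 2^(m − b_k); that is, all Stirling numbers S(j,k) with j ≥ max(n, 2^m) and j ≡ n (mod 2^m) are congruent to each other modulo 2^(m − b_k). -/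
/-- Stirling numbers of the second kind, via the standard recurrence. -/
def stirling2 : ℕ → ℕ → ℕ
  | 0, 0 => 1
  | 0, _ + 1 => 0
  | _ + 1, 0 => 0
  | n + 1, k + 1 => (k + 1) * stirling2 n (k + 1) + stirling2 n k

/-- The congruence class `[n]_t = { j : j ≥ max(n,t) and j ≡ n (mod t) }`. -/
def cls (n t : ℕ) : Set ℕ := {j | max n t ≤ j ∧ j ≡ n [MOD t]}

/-- `b_k = ⌈log₂ k⌉ - 2`. -/
def bk (k : ℕ) : ℕ := Nat.clog 2 k - 2

/-- A set of naturals is constant modulo `M`. -/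
def ConstMod (M : ℕ) (A : Set ℕ) : Prop := ∀ a ∈ A, ∀ b ∈ A, a ≡ b [MOD M]

/-- The image set `S([n]_{2^m}, k)`. -/
def Scls (k n m : ℕ) : Set ℕ := (fun j => stirling2 j k) '' cls n (2 ^ m)

/-- The function `j ↦ ν₂(S(j,k))` is constant on the set `A`. -/
def ValConstOn (k : ℕ) (A : Set ℕ) : Prop :=
  ∀ i ∈ A, ∀ j ∈ A, padicValNat 2 (stirling2 i k) = padicValNat 2 (stirling2 j k)

/-- `N_{k,m}`: the set of `n` with `k ≤ n < k + 2^m` on which `ν₂ ∘ S(·,k)`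
is non-constant on `[n]_{2^m}`. -/
def Nkm (k m : ℕ) : Set ℕ :=
  {n | k ≤ n ∧ n < k + 2 ^ m ∧ ¬ ValConstOn k (cls n (2 ^ m))}

open Polynomial in
/-- The linear functional on `ℤ[X]` sending `X ^ n` to `S(n, k)`. -/
noncomputable def stirlingFunctional (k : ℕ) : ℤ[X] →ₗ[ℤ] ℤ :=
  (Polynomial.basisMonomials ℤ).constr ℤ fun n => (stirling2 n k : ℤ)

open Polynomial in
theorem stirlingFunctional_X_pow (k n : ℕ) :
    stirlingFunctional k (X ^ n) = stirling2 n k := by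
  have h := (Polynomial.basisMonomials ℤ).constr_basis ℤ (fun n => (stirling2 n k : ℤ)) n
  simpa [stirlingFunctional, Polynomial.monomial_one_right_eq_X_pow] using h

open Polynomial in
theorem stirlingFunctional_mul_X_sub (k : ℕ) (p : ℤ[X]) :
    stirlingFunctional (k + 1) (p * (X - C ((k : ℤ) + 1))) = stirlingFunctional k p := by
  induction p using Polynomial.induction_on' with
  | add p q hp hq => rw [add_mul, map_add (stirlingFunctional _), map_add (stirlingFunctional _), hp, hq]
  | monomial n a =>
    have h : monomial n a * (X - C ((k : ℤ) + 1))
        = a • (X ^ (n + 1) - ((k : ℤ) + 1) • X ^ n : ℤ[X]) := by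
      rw [← C_mul_X_pow_eq_monomial, smul_eq_C_mul, smul_eq_C_mul]
      ring
    rw [h, ← C_mul_X_pow_eq_monomial, ← smul_eq_C_mul]
    simp only [map_smul, map_sub, stirlingFunctional_X_pow, stirling2, smul_eq_mul]
    push_cast
    ring

open Polynomial in
/-- The polynomial `(X - 1) (X - 2) ⋯ (X - k)`. -/
noncomputable def stirlingCharPoly (k : ℕ) : ℤ[X] :=
  ∏ i ∈ Finset.range k, (X - C ((i : ℤ) + 1))

open Polynomial in
theorem stirlingCharPoly_succ (k : ℕ) :
    stirlingCharPoly (k + 1) = stirlingCharPoly k * (X - C ((k : ℤ) + 1)) :=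
  Finset.prod_range_succ _ _

open Polynomial in
theorem stirlingFunctional_mul_charPoly (k : ℕ) (p : ℤ[X]) :
    stirlingFunctional k (p * stirlingCharPoly k) = stirlingFunctional 0 p := by
  induction k with
  | zero => simp [stirlingCharPoly]
  | succ k ih => rw [stirlingCharPoly_succ, ← mul_assoc, stirlingFunctional_mul_X_sub, ih]

open Polynomial in
theorem stirlingFunctional_zero_X_mul (p : ℤ[X]) : stirlingFunctional 0 (X * p) = 0 := by
  induction p using Polynomial.induction_on' with
  | add p q hp hq => rw [mul_add, map_add, hp, hq, add_zero]
  | monomial n a =>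
    rw [← C_mul_X_pow_eq_monomial, ← smul_eq_C_mul, mul_smul_comm, ← pow_succ', map_smul,
      stirlingFunctional_X_pow]
    simp [stirling2]

open Polynomial in
theorem two_dvd_stirlingCharPoly_sub (h : ℕ) :
    (2 : ℤ[X]) ∣ stirlingCharPoly (2 * h) - (X * (X - 1)) ^ h := by
  induction h with
  | zero => simp [stirlingCharPoly]
  | succ h ih =>
    obtain ⟨A, hA⟩ := ih
    rw [sub_eq_iff_eq_add] at hA
    rw [show 2 * (h + 1) = 2 * h + 1 + 1 by ring, stirlingCharPoly_succ, stirlingCharPoly_succ, hA]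
    refine ⟨A * (X * (X - 1)) + (2 * A + (X * (X - 1)) ^ h) *
      (-(C (h : ℤ) + 1) * (X - 1) - C (h : ℤ) * X + 2 * C (h : ℤ) * (C (h : ℤ) + 1)), ?_⟩
    push_cast
    simp only [map_add, map_mul, map_one, map_ofNat]
    ring

open Polynomial in
theorem two_dvd_X_pow_two_pow_sub_one_sub (s : ℕ) :
    (2 : ℤ[X]) ∣ X ^ 2 ^ s - 1 - (X - 1) ^ 2 ^ s := by
  induction s with
  | zero => simp
  | succ s ih =>
    obtain ⟨A, hA⟩ := ih
    have h : (X : ℤ[X]) ^ 2 ^ s = 2 * A + (X - 1) ^ 2 ^ s + 1 := by linear_combination hA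
    rw [pow_succ, pow_mul, pow_mul, h]
    exact ⟨2 * A ^ 2 + 2 * A * (X - 1) ^ 2 ^ s + 2 * A + (X - 1) ^ 2 ^ s, by ring⟩

open Polynomial in
theorem exists_X_pow_mul_eq_two_mul (k s : ℕ) (hk : k ≤ 2 * 2 ^ s) :
    ∃ (N : ℕ) (A B : ℤ[X]), X ^ N * (X ^ 2 ^ s - 1) = 2 * A + B * stirlingCharPoly k := by
  obtain ⟨A, hA⟩ := two_dvd_stirlingCharPoly_sub (2 ^ s)
  obtain ⟨A', hA'⟩ := two_dvd_X_pow_two_pow_sub_one_sub s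
  obtain ⟨B, hB⟩ : stirlingCharPoly k ∣ stirlingCharPoly (2 * 2 ^ s) :=
    Finset.prod_dvd_prod_of_subset _ _ _ (Finset.range_subset_range.2 hk)
  refine ⟨2 ^ s, X ^ 2 ^ s * A' - A, B, ?_⟩
  rw [mul_pow] at hA
  linear_combination X ^ 2 ^ s * hA' - hA + hB

open Polynomial in
theorem exists_X_pow_mul_eq_two_pow_mul (k s M : ℕ) (hk : k ≤ 2 * 2 ^ s) :
    ∃ (N : ℕ) (A B : ℤ[X]),
      X ^ N * (X ^ 2 ^ (s + M) - 1) = 2 ^ (M + 1) * A + B * stirlingCharPoly k := by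
  induction M with
  | zero => simpa using exists_X_pow_mul_eq_two_mul k s hk
  | succ M ih =>
    obtain ⟨N, A, B, h⟩ := ih
    refine ⟨2 * N, 2 ^ M * A ^ 2 + X ^ N * A,
      B * (2 ^ (M + 2) * A + B * stirlingCharPoly k) + 2 * X ^ N * B, ?_⟩
    have h2 : (X : ℤ[X]) ^ 2 ^ (s + (M + 1)) = (X ^ 2 ^ (s + M)) ^ 2 := by
      rw [← pow_mul, ← pow_succ, add_assoc]
    rw [h2]
    linear_combination (X ^ N * (X ^ 2 ^ (s + M) - 1)
      + 2 ^ (M + 1) * A + B * stirlingCharPoly k + 2 * X ^ N) * h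

open Polynomial in
/-- Eventual periodicity of `n ↦ S(n, k)` modulo powers of two. -/
theorem exists_forall_two_pow_dvd_stirling2_sub (k s M : ℕ) (hk : k ≤ 2 * 2 ^ s) :
    ∃ N : ℕ, ∀ n, N ≤ n → (2 : ℤ) ^ (M + 1) ∣
      (stirling2 (n + 2 ^ (s + M)) k : ℤ) - stirling2 n k := by
  obtain ⟨N, A, B, h⟩ := exists_X_pow_mul_eq_two_pow_mul k s M hk
  refine ⟨N + 1, fun n hn => ?_⟩
  obtain ⟨d, rfl⟩ := Nat.exists_eq_add_of_le hn
  have e : (X ^ (N + 1 + d + 2 ^ (s + M)) - X ^ (N + 1 + d) : ℤ[X])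
      = (2 : ℤ) ^ (M + 1) • (X ^ (d + 1) * A) + X * (X ^ d * B) * stirlingCharPoly k := by
    rw [smul_eq_C_mul, map_pow, map_ofNat]
    linear_combination X ^ (d + 1) * h
  rw [← stirlingFunctional_X_pow, ← stirlingFunctional_X_pow, ← map_sub, e, map_add,
    stirlingFunctional_mul_charPoly, stirlingFunctional_zero_X_mul, add_zero, map_smul, smul_eq_mul]
  exact dvd_mul_right _ _

theorem factorial_mul_stirling2 (n k : ℕ) :
    (k.factorial * stirling2 n k : ℤ)
      = ∑ t ∈ Finset.range (k + 1), (-1) ^ (k + t) * (k.choose t : ℤ) * (t : ℤ) ^ n := by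
  induction n generalizing k with
  | zero =>
    have h := Int.alternating_sum_range_choose (n := k)
    simp only [pow_zero, mul_one, pow_add, mul_assoc, ← Finset.mul_sum, h]
    cases k <;> simp [stirling2]
  | succ n ih =>
    cases k with
    | zero => simp [stirling2]
    | succ k =>
      have h1 := ih k
      have h2 := ih (k + 1)
      have e : ((k + 1).factorial * stirling2 (n + 1) (k + 1) : ℤ)
          = (k + 1) * ((k + 1).factorial * stirling2 n (k + 1)
            + k.factorial * stirling2 n k) := by
        simp only [stirling2, Nat.factorial_succ]
        push_cast
        ring
      have h1' : (k.factorial * stirling2 n k : ℤ)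
          = ∑ t ∈ Finset.range (k + 2), (-1) ^ (k + t) * (k.choose t : ℤ) * (t : ℤ) ^ n := by
        rw [Finset.sum_range_succ, ← h1]
        simp
      rw [e, h1', h2, ← Finset.sum_add_distrib, Finset.mul_sum]
      refine Finset.sum_congr rfl fun t _ => ?_
      cases t with
      | zero => simp [pow_succ]
      | succ t =>
        have c1 : ((k + 1).choose (t + 1) : ℤ) = k.choose t + k.choose (t + 1) := by
          exact_mod_cast Nat.choose_succ_succ k t
        have c2 : ((k : ℤ) + 1) * k.choose t = (k + 1).choose (t + 1) * (t + 1) := by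
          exact_mod_cast Nat.add_one_mul_choose_eq k t
        push_cast
        linear_combination (-1) ^ (k + t) * ((t : ℤ) + 1) ^ n * c2
          + (-1) ^ (k + t) * ((t : ℤ) + 1) ^ n * (k + 1) * c1

theorem pow_add_totient_mul_modEq (t r j q : ℕ) (hj : r ≤ j) :
    (t : ℤ) ^ (j + (2 ^ r).totient * q) ≡ (t : ℤ) ^ j [ZMOD 2 ^ r] := by
  rcases Nat.even_or_odd t with ht | ht
  · have h : ∀ i, r ≤ i → (t : ℤ) ^ i ≡ 0 [ZMOD 2 ^ r] := fun i hi =>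
      Int.modEq_zero_iff_dvd.2 ((pow_dvd_pow_of_dvd (by exact_mod_cast ht.two_dvd) r).trans
        (pow_dvd_pow _ hi))
    exact (h _ (hj.trans (Nat.le_add_right _ _))).trans (h _ hj).symm
  · have h : t ^ (2 ^ r).totient ≡ 1 [MOD 2 ^ r] :=
      Nat.ModEq.pow_totient ((Nat.coprime_two_right.2 ht).pow_right r)
    have h' : t ^ (j + (2 ^ r).totient * q) ≡ t ^ j [MOD 2 ^ r] := by
      rw [pow_add, pow_mul]
      simpa using (h.pow q).mul_left (t ^ j)
    exact_mod_cast (Int.natCast_modEq_iff.2 h')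

theorem factorial_mul_stirling2_modEq (k r j q : ℕ) (hj : r ≤ j) :
    (k.factorial * stirling2 (j + (2 ^ r).totient * q) k : ℤ)
      ≡ k.factorial * stirling2 j k [ZMOD 2 ^ r] := by
  rw [factorial_mul_stirling2, factorial_mul_stirling2]
  exact Int.ModEq.sum fun t _ => (pow_add_totient_mul_modEq t r j q hj).mul_left _

theorem two_pow_dvd_of_two_pow_add_padicValNat_dvd_mul {M a : ℕ} {z : ℤ} (ha : a ≠ 0)
    (h : (2 : ℤ) ^ (M + padicValNat 2 a) ∣ a * z) : (2 : ℤ) ^ M ∣ z := by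
  rcases eq_or_ne z 0 with rfl | hz
  · exact dvd_zero _
  have ha' : (a : ℤ) ≠ 0 := by exact_mod_cast ha
  have h2 : (2 : ℤ) = ((2 : ℕ) : ℤ) := rfl
  rw [h2, padicValInt_dvd_iff] at h ⊢
  rw [padicValInt.mul ha' hz, padicValInt.of_nat] at h
  exact Or.inr (by have := h.resolve_left (mul_ne_zero ha' hz); omega)

theorem two_pow_dvd_stirling2_add_sub (k s M j : ℕ) (hk : k ≤ 2 * 2 ^ s)
    (hj : M + 1 + padicValNat 2 k.factorial ≤ j) :
    (2 : ℤ) ^ (M + 1) ∣ (stirling2 (j + 2 ^ (s + M)) k : ℤ) - stirling2 j k := by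
  obtain ⟨N, hN⟩ := exists_forall_two_pow_dvd_stirling2_sub k s M hk
  refine two_pow_dvd_of_two_pow_add_padicValNat_dvd_mul k.factorial_ne_zero ?_
  set r := M + 1 + padicValNat 2 k.factorial with hr
  have hpos : 0 < (2 ^ r).totient := Nat.totient_pos.2 (by positivity)
  have hfar := hN (j + (2 ^ r).totient * N)
    ((Nat.le_mul_of_pos_left N hpos).trans (Nat.le_add_left _ _))
  have hfac : (2 : ℤ) ^ padicValNat 2 k.factorial ∣ k.factorial := by
    exact_mod_cast pow_padicValNat_dvd
  have hmul := mul_dvd_mul hfac hfar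
  rw [← pow_add, add_comm (padicValNat _ _), ← hr] at hmul
  have h1 := factorial_mul_stirling2_modEq k r j N hj
  have h2 := factorial_mul_stirling2_modEq k r (j + 2 ^ (s + M)) N
    (hj.trans (Nat.le_add_right _ _))
  have h3 := h2.sub h1
  rw [add_right_comm, ← mul_sub, ← mul_sub] at h3
  exact (Int.ModEq.dvd_iff h3).1 hmul

theorem kwong_ext (k m n : ℕ) (hkn : k ≤ n) (hk : 5 ≤ k) (hm : bk k ≤ m)
    (h2m : m - bk k + padicValNat 2 (Nat.factorial k) ≤ 2 ^ m) :
    ConstMod (2 ^ (m - bk k)) (Scls k n m) := by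
  obtain ⟨M', rfl⟩ := Nat.exists_eq_add_of_le hm
  rw [Nat.add_sub_cancel_left] at *
  cases M' with
  | zero => exact fun a _ b _ => by simp [Nat.modEq_one]
  | succ M =>
    have hclog : 2 < Nat.clog 2 k := (Nat.lt_clog_iff_pow_lt (by norm_num)).2 (by omega)
    have hks : k ≤ 2 * 2 ^ (bk k + 1) := by
      rw [← pow_succ', show bk k + 1 + 1 = Nat.clog 2 k by unfold bk; omega]
      exact Nat.le_pow_clog (by norm_num) k
    have step : ∀ j, 2 ^ (bk k + (M + 1)) ≤ j → ∀ q,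
        stirling2 j k ≡ stirling2 (j + 2 ^ (bk k + (M + 1)) * q) k [MOD 2 ^ (M + 1)] := by
      intro j hj q
      induction q with
      | zero => exact Nat.ModEq.refl _
      | succ q ih =>
        refine ih.trans ?_
        have h := two_pow_dvd_stirling2_add_sub k (bk k + 1) M
          (j + 2 ^ (bk k + (M + 1)) * q) hks (h2m.trans (hj.trans (Nat.le_add_right _ _)))
        rw [show bk k + 1 + M = bk k + (M + 1) by ring] at h
        rw [mul_add_one, ← add_assoc j, Nat.modEq_iff_dvd]
        simpa using h
    have main : ∀ a ∈ cls n (2 ^ (bk k + (M + 1))), ∀ b ∈ cls n (2 ^ (bk k + (M + 1))), a ≤ b →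
        stirling2 a k ≡ stirling2 b k [MOD 2 ^ (M + 1)] := by
      rintro a ⟨ha, ha'⟩ b ⟨-, hb'⟩ hab
      obtain ⟨q, hq⟩ := (Nat.modEq_iff_dvd' hab).1 (ha'.trans hb'.symm)
      rw [← Nat.add_sub_cancel' hab, hq]
      exact step a ((le_max_right _ _).trans ha) q
    rintro _ ⟨a, ha, rfl⟩ _ ⟨b, hb, rfl⟩
    rcases le_total a b with hab | hab
    · exact main a ha b hb hab
    · exact (main b hb a ha hab).symm
end

section
/- Let k, m, n be non-negative integers with n ≥ k ≥ 5, m ≥ b_k, and 2^m ≥ m − b_k + ν₂(k!). If the function j ↦ ν₂(S(j,k)) is non-constant on [n]_{2^m}, then S(j,k) ≡ 0 (mod 2^(m − b_k)) for every j ∈ [n]_{2^m}. -/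
open Polynomial in
/-- The `k`-th finite difference at `0` of an integer polynomial. -/
noncomputable def finiteDiff (k : ℕ) (f : ℤ[X]) : ℤ :=
  ∑ t ∈ Finset.range (k + 1), (-1) ^ (k + t) * (k.choose t : ℤ) * f.eval (t : ℤ)

open Polynomial in
theorem finiteDiff_X_pow_succ (k n : ℕ) :
    finiteDiff (k + 1) (X ^ (n + 1)) =
      (k + 1) * (finiteDiff (k + 1) (X ^ n) + finiteDiff k (X ^ n)) := by
  have hext : finiteDiff k (X ^ n) = ∑ t ∈ Finset.range (k + 1 + 1),
      (-1) ^ (k + t) * (k.choose t : ℤ) * (X ^ n : ℤ[X]).eval (t : ℤ) := by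
    rw [Finset.sum_range_succ, Nat.choose_succ_self]
    simp [finiteDiff]
  rw [hext, finiteDiff, finiteDiff, ← Finset.sum_add_distrib, Finset.mul_sum]
  refine Finset.sum_congr rfl fun t _ => ?_
  have key : (t : ℤ) * ((k + 1).choose t : ℤ) =
      (k + 1) * (((k + 1).choose t : ℤ) - (k.choose t : ℤ)) := by
    cases t with
    | zero => simp
    | succ s =>
      have h1 := Nat.add_one_mul_choose_eq k s
      have h2 := Nat.choose_succ_succ k s
      have h1' : ((k : ℤ) + 1) * (k.choose s : ℤ) = ((k + 1).choose (s + 1) : ℤ) * (s + 1) := by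
        exact_mod_cast h1
      have h2' : ((k + 1).choose (s + 1) : ℤ) = (k.choose s : ℤ) + (k.choose (s + 1) : ℤ) := by
        exact_mod_cast h2
      push_cast
      linear_combination (-1 : ℤ) * h1' - ((k : ℤ) + 1) * h2'
  simp only [eval_pow, eval_X]
  linear_combination (-1 : ℤ) ^ (k + 1 + t) * (t : ℤ) ^ n * key

open Polynomial in
theorem finiteDiff_X_pow (n k : ℕ) :
    finiteDiff k (X ^ n) = (k.factorial : ℤ) * (stirling2 n k : ℤ) := by
  induction n generalizing k with
  | zero =>
    cases k with
    | zero => simp [finiteDiff, stirling2]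
    | succ k =>
      have h := Int.alternating_sum_range_choose_of_ne (Nat.succ_ne_zero k)
      have : finiteDiff (k + 1) (X ^ 0) = (-1) ^ (k + 1) *
          ∑ t ∈ Finset.range (k + 1 + 1), (-1 : ℤ) ^ t * ((k + 1).choose t : ℤ) := by
        rw [finiteDiff, Finset.mul_sum]
        refine Finset.sum_congr rfl fun t _ => ?_
        simp only [pow_zero, eval_one]
        ring
      rw [this, h]
      simp [stirling2]
  | succ n ih =>
    cases k with
    | zero => simp [finiteDiff, stirling2]
    | succ k =>
      rw [finiteDiff_X_pow_succ, ih, ih, stirling2, Nat.factorial_succ]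
      push_cast
      ring

open Polynomial in
theorem finiteDiff_add (k : ℕ) (f g : ℤ[X]) :
    finiteDiff k (f + g) = finiteDiff k f + finiteDiff k g := by
  simp only [finiteDiff, eval_add, mul_add, Finset.sum_add_distrib]

open Polynomial in
theorem finiteDiff_C_mul (k : ℕ) (a : ℤ) (f : ℤ[X]) :
    finiteDiff k (C a * f) = a * finiteDiff k f := by
  simp only [finiteDiff, eval_mul, eval_C, Finset.mul_sum]
  exact Finset.sum_congr rfl fun t _ => by ring

open Polynomial in
theorem factorial_dvd_finiteDiff (k : ℕ) (f : ℤ[X]) : (k.factorial : ℤ) ∣ finiteDiff k f := by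
  induction f using Polynomial.induction_on' with
  | add p q hp hq => rw [finiteDiff_add]; exact dvd_add hp hq
  | monomial n a =>
    rw [← C_mul_X_pow_eq_monomial, finiteDiff_C_mul, finiteDiff_X_pow]
    exact Dvd.intro_left (a * (stirling2 n k : ℤ)) (by ring)

theorem exists_prod_sub_odd_eq {R : Type*} [CommRing R] (x : R) (n : ℕ) :
    ∃ d, ∏ i ∈ Finset.range n, (x - (2 * (i : R) + 1)) = (x - 1) ^ n + 2 * d := by
  induction n with
  | zero => exact ⟨0, by simp⟩
  | succ n ih =>
    obtain ⟨d, hd⟩ := ih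
    refine ⟨d * (x - (2 * n + 1)) - (x - 1) ^ n * n, ?_⟩
    rw [Finset.prod_range_succ, hd]
    ring

theorem exists_prod_sub_even_eq {R : Type*} [CommRing R] (x : R) (n : ℕ) :
    ∃ d, ∏ i ∈ Finset.range n, (x - 2 * (i : R)) = x ^ n + 2 * d := by
  induction n with
  | zero => exact ⟨0, by simp⟩
  | succ n ih =>
    obtain ⟨d, hd⟩ := ih
    refine ⟨d * (x - 2 * n) - x ^ n * n, ?_⟩
    rw [Finset.prod_range_succ, hd]
    ring

theorem exists_sub_one_pow_two_pow_eq {R : Type*} [CommRing R] (x : R) (c : ℕ) :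
    ∃ d, (x - 1) ^ 2 ^ c = x ^ 2 ^ c - 1 + 2 * d := by
  induction c with
  | zero => exact ⟨0, by simp⟩
  | succ c ih =>
    obtain ⟨d, hd⟩ := ih
    refine ⟨2 * d ^ 2 + 2 * d * (x ^ 2 ^ c - 1) - x ^ 2 ^ c + 1, ?_⟩
    rw [pow_succ, pow_mul, pow_mul, hd]
    ring

/-- Modulo `2 ^ (N + 1)` and `∏ (x - (2 i + 1))`, over `i < 2 ^ c`,
the power `x ^ 2 ^ (N + c)` is `1`. -/
theorem exists_pow_two_pow_sub_one_eq {R : Type*} [CommRing R] (x : R) (c N : ℕ) :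
    ∃ a b, x ^ 2 ^ (N + c) - 1 =
      2 ^ (N + 1) * a + (∏ i ∈ Finset.range (2 ^ c), (x - (2 * (i : R) + 1))) * b := by
  induction N with
  | zero =>
    obtain ⟨d, hd⟩ := exists_prod_sub_odd_eq x (2 ^ c)
    obtain ⟨e, he⟩ := exists_sub_one_pow_two_pow_eq x c
    refine ⟨-d - e, 1, ?_⟩
    rw [hd, he, zero_add]
    ring
  | succ N ih =>
    obtain ⟨a, b, h⟩ := ih
    set q := ∏ i ∈ Finset.range (2 ^ c), (x - (2 * (i : R) + 1))
    refine ⟨2 ^ N * a ^ 2 + a, b * (2 ^ (N + 2) * a + q * b + 2), ?_⟩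
    rw [show N + 1 + c = N + c + 1 by ring, pow_succ 2 (N + c), pow_mul]
    rw [sub_eq_iff_eq_add] at h
    rw [h]
    ring

theorem exists_pow_eq {R : Type*} [CommRing R] (x : R) (s N : ℕ) :
    ∃ a b, x ^ (s * N) = 2 ^ N * a + (∏ i ∈ Finset.range s, (x - 2 * (i : R))) * b := by
  obtain ⟨d, hd⟩ := exists_prod_sub_even_eq x s
  obtain ⟨b, hb⟩ := sub_dvd_pow_sub_pow (x ^ s) (-2 * d) N
  refine ⟨(-d) ^ N, b, ?_⟩
  rw [hd, pow_mul, ← mul_pow]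
  linear_combination hb + congrArg (· ^ N) (show -2 * d = 2 * -d by ring)

open Polynomial in
theorem finiteDiff_eq_zero_of_eval {k : ℕ} {f : ℤ[X]} (h : ∀ t ≤ k, f.eval (t : ℤ) = 0) :
    finiteDiff k f = 0 :=
  Finset.sum_eq_zero fun t ht => by
    rw [h t (Nat.lt_succ_iff.mp (Finset.mem_range.mp ht)), mul_zero]

open Polynomial in
theorem two_pow_mul_factorial_dvd_finiteDiff {k c : ℕ} (hk : k ≤ 2 ^ (c + 1)) (N : ℕ) (g : ℤ[X]) :
    (2 ^ (N + 1) * k.factorial : ℤ) ∣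
      finiteDiff k (X ^ ((2 ^ c + 1) * (N + 1)) * (X ^ 2 ^ (N + c) - 1) * g) := by
  obtain ⟨a, b, h⟩ := exists_pow_two_pow_sub_one_eq (X : ℤ[X]) c N
  obtain ⟨a', b', h'⟩ := exists_pow_eq (X : ℤ[X]) (2 ^ c + 1) (N + 1)
  set q := ∏ i ∈ Finset.range (2 ^ c), ((X : ℤ[X]) - (2 * (i : ℤ[X]) + 1)) with hq
  set p := ∏ i ∈ Finset.range (2 ^ c + 1), ((X : ℤ[X]) - 2 * (i : ℤ[X])) with hp
  have hsplit : X ^ ((2 ^ c + 1) * (N + 1)) * (X ^ 2 ^ (N + c) - 1) * g =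
      C (2 ^ (N + 1)) * ((a' * (2 ^ (N + 1) * a + q * b) + p * b' * a) * g) +
        p * q * (b' * b * g) := by
    rw [h, h', C_pow, show (C 2 : ℤ[X]) = 2 from rfl]
    ring
  have hzero : finiteDiff k (p * q * (b' * b * g)) = 0 := by
    refine finiteDiff_eq_zero_of_eval fun t ht => ?_
    have : p.eval (t : ℤ) = 0 ∨ q.eval (t : ℤ) = 0 := by
      rw [hp, hq, eval_prod, eval_prod]
      rw [pow_succ] at hk
      rcases Nat.even_or_odd' t with ⟨i, hi | hi⟩
      · refine Or.inl (Finset.prod_eq_zero (i := i) (Finset.mem_range.mpr (by omega)) ?_)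
        simp [hi]
      · refine Or.inr (Finset.prod_eq_zero (i := i) (Finset.mem_range.mpr (by omega)) ?_)
        simp [hi]
    rcases this with h | h <;> simp [h]
  rw [hsplit, finiteDiff_add, hzero, add_zero, finiteDiff_C_mul]
  exact mul_dvd_mul_left _ (factorial_dvd_finiteDiff _ _)

theorem two_pow_dvd_pow_add_sub_pow {j M : ℕ} (hj : M ≤ j) (t s : ℕ) :
    (2 ^ M : ℤ) ∣ (t : ℤ) ^ (j + Nat.totient (2 ^ M) * s) - (t : ℤ) ^ j := by
  rcases Nat.even_or_odd t with ht | ht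
  · have h2 : (2 : ℤ) ∣ t := by exact_mod_cast ht.two_dvd
    exact dvd_sub ((pow_dvd_pow_of_dvd h2 M).trans (pow_dvd_pow _ (by omega)))
      ((pow_dvd_pow_of_dvd h2 M).trans (pow_dvd_pow _ hj))
  · have h := (Nat.ModEq.pow_totient
      (Nat.Coprime.pow_right M (Nat.coprime_two_right.mpr ht))).pow s
    rw [one_pow, ← pow_mul] at h
    have h' := (Nat.modEq_iff_dvd.mp h.symm)
    push_cast at h'
    rw [pow_add, ← mul_sub_one]
    exact Dvd.dvd.mul_left h' _

open Polynomial in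
theorem stirling2_add_two_pow_modEq {k c N j : ℕ} (hk : k ≤ 2 ^ (c + 1))
    (hj : N + 1 + padicValNat 2 k.factorial ≤ j) :
    stirling2 j k ≡ stirling2 (j + 2 ^ (N + c)) k [MOD 2 ^ (N + 1)] := by
  set v := padicValNat 2 k.factorial with hv
  set M := N + 1 + v with hM
  set s := (2 ^ c + 1) * (N + 1) with hs
  obtain ⟨u, hu⟩ : 2 ^ v ∣ k.factorial := pow_padicValNat_dvd
  have hu2 : ¬ 2 ∣ u := fun ⟨w, hw⟩ =>
    pow_succ_padicValNat_not_dvd (p := 2) (Nat.factorial_ne_zero k)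
      ⟨w, by rw [← hv, hu, hw]; ring⟩
  have hφ : s ≤ Nat.totient (2 ^ M) * s :=
    Nat.le_mul_of_pos_left _ (Nat.totient_pos.mpr (by positivity))
  obtain ⟨r, hr⟩ := Nat.exists_eq_add_of_le hφ
  have hbig : (2 ^ M : ℤ) ∣
      finiteDiff k (X ^ (j + Nat.totient (2 ^ M) * s) * (X ^ 2 ^ (N + c) - 1)) := by
    have h := two_pow_mul_factorial_dvd_finiteDiff hk N (X ^ (j + r))
    rw [← hs] at h
    rw [show (X : ℤ[X]) ^ (j + Nat.totient (2 ^ M) * s) * (X ^ 2 ^ (N + c) - 1) =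
      X ^ s * (X ^ 2 ^ (N + c) - 1) * X ^ (j + r) by rw [hr]; ring]
    refine dvd_trans ⟨u, ?_⟩ h
    rw [hu, hM, pow_add]
    push_cast
    ring
  have hdiff : (2 ^ M : ℤ) ∣
      finiteDiff k (X ^ (j + Nat.totient (2 ^ M) * s) * (X ^ 2 ^ (N + c) - 1)) -
        finiteDiff k (X ^ j * (X ^ 2 ^ (N + c) - 1)) := by
    rw [finiteDiff, finiteDiff, ← Finset.sum_sub_distrib]
    refine Finset.dvd_sum fun t _ => ?_
    rw [← mul_sub]
    refine Dvd.dvd.mul_left ?_ _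
    simp only [eval_mul, eval_pow, eval_X, eval_sub, eval_one]
    rw [← sub_mul]
    exact Dvd.dvd.mul_right (two_pow_dvd_pow_add_sub_pow hj t s) _
  have hsmall := (dvd_sub_right hbig).mp hdiff
  rw [show (X : ℤ[X]) ^ j * (X ^ 2 ^ (N + c) - 1) = X ^ (j + 2 ^ (N + c)) + C (-1) * X ^ j by
    rw [C_neg, C_1]; ring, finiteDiff_add, finiteDiff_C_mul, finiteDiff_X_pow,
    finiteDiff_X_pow] at hsmall
  have hfac : (2 ^ v * 2 ^ (N + 1) : ℤ) ∣
      2 ^ v * (u * ((stirling2 (j + 2 ^ (N + c)) k : ℤ) - stirling2 j k)) := by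
    rw [← pow_add, show v + (N + 1) = M by omega]
    refine hsmall.trans (dvd_of_eq ?_)
    rw [hu]
    push_cast
    ring
  have hcop : IsCoprime (2 ^ (N + 1) : ℤ) (u : ℤ) := by
    refine IsCoprime.pow_left ?_
    exact_mod_cast Nat.isCoprime_iff_coprime.mpr
      ((Nat.Prime.coprime_iff_not_dvd Nat.prime_two).mpr hu2)
  rw [Nat.modEq_iff_dvd]
  push_cast
  exact hcop.dvd_of_dvd_mul_left ((mul_dvd_mul_iff_left (by positivity)).mp hfac)

theorem stirling2_add_mul_two_pow_modEq {k c N j : ℕ} (hk : k ≤ 2 ^ (c + 1))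
    (hj : N + 1 + padicValNat 2 k.factorial ≤ j) (q : ℕ) :
    stirling2 j k ≡ stirling2 (j + 2 ^ (N + c) * q) k [MOD 2 ^ (N + 1)] := by
  induction q with
  | zero => rfl
  | succ q ih =>
    rw [mul_add_one, ← add_assoc]
    exact ih.trans (stirling2_add_two_pow_modEq hk (hj.trans (Nat.le_add_right _ _)))

theorem padicValNat_eq_of_modEq {p N a b : ℕ} [Fact p.Prime] (h : a ≡ b [MOD p ^ N])
    (ha : ¬ p ^ N ∣ a) : padicValNat p a = padicValNat p b := by
  have hb : ¬ p ^ N ∣ b := fun hb => ha ((h.dvd_iff dvd_rfl).mpr hb)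
  have key : ∀ {x y : ℕ}, x ≡ y [MOD p ^ N] → ¬ p ^ N ∣ x → ¬ p ^ N ∣ y →
      padicValNat p x ≤ padicValNat p y := by
    intro x y hxy hx hy
    have hx0 : x ≠ 0 := fun h0 => hx (h0 ▸ dvd_zero _)
    have hy0 : y ≠ 0 := fun h0 => hy (h0 ▸ dvd_zero _)
    have hlt : padicValNat p x < N := by
      by_contra! hle
      exact hx ((padicValNat_dvd_iff_le hx0).mpr hle)
    exact (padicValNat_dvd_iff_le hy0).mp
      ((hxy.dvd_iff (pow_dvd_pow p hlt.le)).mp pow_padicValNat_dvd)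
  exact (key h ha hb).antisymm (key h.symm hb ha)

theorem translate_S_nu (k m n : ℕ) (hkn : k ≤ n) (hk : 5 ≤ k) (hm : bk k ≤ m)
    (h2m : m - bk k + padicValNat 2 (Nat.factorial k) ≤ 2 ^ m)
    (hnc : ¬ ValConstOn k (cls n (2 ^ m))) :
    ∀ j ∈ cls n (2 ^ m), stirling2 j k ≡ 0 [MOD 2 ^ (m - bk k)] := by
  obtain ⟨c, hc⟩ : ∃ c, Nat.clog 2 k = c + 2 := by
    have h : 2 < Nat.clog 2 k := (Nat.lt_clog_iff_pow_lt (by norm_num)).mpr (by omega)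
    exact ⟨Nat.clog 2 k - 2, by omega⟩
  have hk2 : k ≤ 2 ^ (c + 1 + 1) := hc ▸ Nat.le_pow_clog (by norm_num) k
  have hb : bk k = c := by simp [bk, hc]
  rw [hb] at hm h2m ⊢
  intro j hj
  obtain hN | ⟨N, hN⟩ : m - c = 0 ∨ ∃ N, m - c = N + 1 :=
    (Nat.eq_zero_or_eq_succ_pred (m - c)).imp id fun h => ⟨_, h⟩
  · rw [hN, pow_zero]
    exact Nat.modEq_one
  obtain rfl : m = N + (c + 1) := by omega
  rw [hN] at h2m ⊢
  have hle : ∀ x ∈ cls n (2 ^ (N + (c + 1))), ∀ y ∈ cls n (2 ^ (N + (c + 1))), x ≤ y →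
      stirling2 x k ≡ stirling2 y k [MOD 2 ^ (N + 1)] := by
    intro x hx y hy hxy
    obtain ⟨q, hq⟩ := (Nat.modEq_iff_dvd' hxy).mp (hx.2.trans hy.2.symm)
    obtain rfl : y = x + 2 ^ (N + (c + 1)) * q := by omega
    exact stirling2_add_mul_two_pow_modEq hk2
      (h2m.trans ((le_max_right n _).trans hx.1)) q
  have hconst : ∀ x ∈ cls n (2 ^ (N + (c + 1))), ∀ y ∈ cls n (2 ^ (N + (c + 1))),
      stirling2 x k ≡ stirling2 y k [MOD 2 ^ (N + 1)] := fun x hx y hy =>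
    (le_total x y).elim (hle x hx y hy) fun h => (hle y hy x hx h).symm
  by_contra hne
  rw [Nat.modEq_zero_iff_dvd] at hne
  refine hnc fun x hx y hy => ?_
  exact (padicValNat_eq_of_modEq (hconst j hj x hx) hne).symm.trans
    (padicValNat_eq_of_modEq (hconst j hj y hy) hne)
end

section
/- Let k, M be non-negative integers with k ≥ 5, M ≥ b_k, and 2^M ≥ M − b_k + ν₂(k!). For each j ∈ N_{k,M}, let ℓ_j be a non-negative integer, and suppose that for every integer n ≥ k with n ≡ j (mod 2^M) for some j ∈ N_{k,M}, and for all m ≥ M: (i) S([n]_{2^m}, k) is not constant modulo 2^(m − b_k + ℓ_j + 1), and (ii) S([n]_{2^m}, k) is constant modulo 2^(m − b_k + ℓ_j). Then for every m ≥ M: (a) the number of classes [n]_{2^m} (with k ≤ n < k + 2^m) on which j ↦ ν₂(S(j,k)) is non-constant equals #N_{k,M}; and (b) whenever j ↦ ν₂(S(j,k)) is non-constant on a class [n]_{2^m}, it is non-constant on exactly one of the two children [n]_{2^(m+1)} and [n + 2^m]_{2^(m+1)}. -/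
theorem stirling2_pos {k : ℕ} : ∀ {n : ℕ}, 1 ≤ k → k ≤ n → 0 < stirling2 n k := by
  intro n
  induction n generalizing k with
  | zero => omega
  | succ n ih =>
    intro hk hkn
    obtain ⟨k, rfl⟩ := Nat.exists_eq_add_of_le' hk
    rw [stirling2]
    rcases hkn.lt_or_eq with h | h
    · exact Nat.add_pos_left (Nat.mul_pos k.succ_pos (ih hk (by omega))) _
    · obtain rfl : k = n := by omega
      rcases k.eq_zero_or_pos with rfl | hk0
      · simp [stirling2]
      · exact Nat.add_pos_right _ (ih hk0 le_rfl)

theorem padicValNat_two_eq_of_modEq {c x y : ℕ} (h : x ≡ y [MOD 2 ^ c]) (hx : ¬ 2 ^ c ∣ x) :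
    padicValNat 2 x = padicValNat 2 y := by
  have hy : ¬ 2 ^ c ∣ y := fun hy => hx ((h.dvd_iff dvd_rfl).2 hy)
  have hx0 : x ≠ 0 := fun h0 => hx (h0 ▸ dvd_zero _)
  have hy0 : y ≠ 0 := fun h0 => hy (h0 ▸ dvd_zero _)
  rw [padicValNat_dvd_iff_le hx0] at hx
  rw [padicValNat_dvd_iff_le hy0] at hy
  apply le_antisymm
  · rw [← padicValNat_dvd_iff_le hy0,
      ← h.dvd_iff (pow_dvd_pow 2 (by omega)), padicValNat_dvd_iff_le hx0]
  · rw [← padicValNat_dvd_iff_le hx0,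
      h.dvd_iff (pow_dvd_pow 2 (by omega)), padicValNat_dvd_iff_le hy0]

/-- Two odd multiples of `2 ^ c` agree modulo `2 ^ (c + 1)`. -/
theorem modEq_two_pow_succ_of_not_dvd {c x y : ℕ} (hx : 2 ^ c ∣ x) (hy : 2 ^ c ∣ y)
    (hx' : ¬ 2 ^ (c + 1) ∣ x) (hy' : ¬ 2 ^ (c + 1) ∣ y) : x ≡ y [MOD 2 ^ (c + 1)] := by
  obtain ⟨a, rfl⟩ := hx
  obtain ⟨b, rfl⟩ := hy
  rw [pow_succ, Nat.mul_dvd_mul_iff_left (by positivity)] at hx' hy'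
  rw [pow_succ]
  exact Nat.ModEq.mul_left' _ (show a % 2 = b % 2 by omega)

/-- When `c` is the largest exponent for which the Stirling numbers over `A` agree modulo `2 ^ c`,
their valuation varies on `A` exactly when `2 ^ c` divides all of them. -/
theorem not_valConstOn_iff {k c : ℕ} {A : Set ℕ} (hpos : ∀ a ∈ A, stirling2 a k ≠ 0)
    (hc : ConstMod (2 ^ c) ((fun j => stirling2 j k) '' A))
    (hc' : ¬ ConstMod (2 ^ (c + 1)) ((fun j => stirling2 j k) '' A)) :
    ¬ ValConstOn k A ↔ ∀ a ∈ A, 2 ^ c ∣ stirling2 a k := by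
  constructor
  · intro hv a ha
    by_contra hd
    have key : ∀ i ∈ A, padicValNat 2 (stirling2 a k) = padicValNat 2 (stirling2 i k) :=
      fun i hi => padicValNat_two_eq_of_modEq (hc _ ⟨a, ha, rfl⟩ _ ⟨i, hi, rfl⟩) hd
    exact hv fun i hi j hj => (key i hi).symm.trans (key j hj)
  · intro hd hv
    apply hc'
    rintro _ ⟨i, hi, rfl⟩ _ ⟨j, hj, rfl⟩
    have hij : 2 ^ (c + 1) ∣ stirling2 i k ↔ 2 ^ (c + 1) ∣ stirling2 j k := by
      rw [padicValNat_dvd_iff_le (hpos i hi), padicValNat_dvd_iff_le (hpos j hj), hv i hi j hj]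
    by_cases h : 2 ^ (c + 1) ∣ stirling2 i k
    · exact (Nat.modEq_zero_iff_dvd.2 h).trans (Nat.modEq_zero_iff_dvd.2 (hij.1 h)).symm
    · exact modEq_two_pow_succ_of_not_dvd (hd i hi) (hd j hj) h (mt hij.2 h)

theorem ValConstOn.mono {k : ℕ} {A B : Set ℕ} (hAB : A ⊆ B) (h : ValConstOn k B) :
    ValConstOn k A :=
  fun i hi j hj => h i (hAB hi) j (hAB hj)

theorem cls_subset_cls {n n' m m' : ℕ} (hm : m' ≤ m) (hn : n' ≤ n) (h : n ≡ n' [MOD 2 ^ m']) :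
    cls n (2 ^ m) ⊆ cls n' (2 ^ m') := fun _ hj =>
  ⟨(max_le_max hn (Nat.pow_le_pow_right two_pos hm)).trans hj.1,
    (hj.2.of_dvd (pow_dvd_pow 2 hm)).trans h⟩

theorem exists_mem_Nkm_modEq {k M m n : ℕ} (hm : M ≤ m) (hn : k ≤ n)
    (hv : ¬ ValConstOn k (cls n (2 ^ m))) : ∃ j ∈ Nkm k M, n ≡ j [MOD 2 ^ M] := by
  have hlt := Nat.mod_lt (n - k) (Nat.two_pow_pos M)
  have hle := Nat.mod_le (n - k) (2 ^ M)
  have hmod : n ≡ k + (n - k) % 2 ^ M [MOD 2 ^ M] := by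
    conv_lhs => rw [← Nat.add_sub_cancel' hn]
    exact (Nat.mod_modEq _ _).symm.add_left k
  exact ⟨_, ⟨by omega, by omega, mt (ValConstOn.mono (cls_subset_cls hm (by omega) hmod)) hv⟩, hmod⟩

theorem add_two_pow_modEq (n m : ℕ) : n + 2 ^ m ≡ n [MOD 2 ^ m] :=
  Nat.add_modEq_right

theorem mem_children_of_mem_cls {n m j : ℕ} (hj : j ∈ cls (n + 2 ^ (m + 1)) (2 ^ m)) :
    j ∈ cls n (2 ^ (m + 1)) ∪ cls (n + 2 ^ m) (2 ^ (m + 1)) := by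
  obtain ⟨hle, hmod⟩ := hj
  have hle' := (le_max_left _ _).trans hle
  obtain ⟨d, hd⟩ := (Nat.modEq_iff_dvd' hle').1 hmod.symm
  obtain rfl : j = n + 2 ^ (m + 1) + 2 ^ m * d := by omega
  have hp : 2 ^ (m + 1) = 2 ^ m * 2 := pow_succ 2 m
  have hpow := Nat.two_pow_pos m
  rcases Nat.even_or_odd' d with ⟨e, rfl | rfl⟩
  · refine Or.inl ⟨max_le (by omega) (by omega), ?_⟩
    rw [show n + 2 ^ (m + 1) + 2 ^ m * (2 * e) = n + 2 ^ (m + 1) * (e + 1) by rw [hp]; ring]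
    simp [Nat.ModEq]
  · have he : n + 2 ^ (m + 1) + 2 ^ m * (2 * e + 1) = n + 2 ^ m + 2 ^ (m + 1) * (e + 1) := by
      rw [hp]; ring
    refine Or.inr ⟨max_le ?_ (by omega), ?_⟩
    · rw [he]; exact Nat.le_add_right _ _
    · rw [he]; simp [Nat.ModEq]

theorem ncard_Nkm_succ {k m : ℕ}
    (h : ∀ n, k ≤ n → ¬ ValConstOn k (cls n (2 ^ m)) →
      Xor (¬ ValConstOn k (cls n (2 ^ (m + 1))))
        (¬ ValConstOn k (cls (n + 2 ^ m) (2 ^ (m + 1))))) :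
    (Nkm k (m + 1)).ncard = (Nkm k m).ncard := by
  have hp : 2 ^ (m + 1) = 2 ^ m * 2 := pow_succ 2 m
  have hpar : ∀ n, ¬ ValConstOn k (cls n (2 ^ (m + 1))) → ¬ ValConstOn k (cls n (2 ^ m)) :=
    fun n => mt (ValConstOn.mono (cls_subset_cls m.le_succ le_rfl rfl))
  have hpar' : ∀ n, ¬ ValConstOn k (cls (n + 2 ^ m) (2 ^ (m + 1))) →
      ¬ ValConstOn k (cls n (2 ^ m)) := fun n =>
    mt (ValConstOn.mono (cls_subset_cls m.le_succ (Nat.le_add_right _ _) (add_two_pow_modEq n m)))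
  have hnot : ∀ n, k ≤ n → ¬ ValConstOn k (cls n (2 ^ (m + 1))) →
      ¬ ValConstOn k (cls (n + 2 ^ m) (2 ^ (m + 1))) → False := fun n hn h₁ h₂ =>
    (h n hn (hpar n h₁)).elim (fun hx => hx.2 h₂) (fun hx => hx.2 h₁)
  refine Set.ncard_congr (fun n _ => if n < k + 2 ^ m then n else n - 2 ^ m) ?_ ?_ ?_
  · rintro n ⟨hkn, hlt, hv⟩
    split_ifs with hn
    · exact ⟨hkn, hn, hpar n hv⟩
    · refine ⟨by omega, by omega, hpar' _ ?_⟩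
      rwa [Nat.sub_add_cancel (by omega)]
  · rintro a b ⟨hka, -, hva⟩ ⟨hkb, -, hvb⟩ hab
    split_ifs at hab with ha hb hb
    · exact hab
    · obtain rfl : b = a + 2 ^ m := by omega
      exact (hnot a hka hva hvb).elim
    · obtain rfl : a = b + 2 ^ m := by omega
      exact (hnot b hkb hvb hva).elim
    · omega
  · rintro n ⟨hkn, hlt, hv⟩
    rcases h n hkn hv with ⟨h₁, -⟩ | ⟨h₂, -⟩
    · exact ⟨n, ⟨hkn, by omega, h₁⟩, if_pos hlt⟩
    · exact ⟨n + 2 ^ m, ⟨by omega, by omega, h₂⟩, by simp [show ¬ n < k by omega]⟩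

theorem main_theorem (k M : ℕ) (hk : 5 ≤ k) (hM : bk k ≤ M)
    (h2M : M - bk k + padicValNat 2 (Nat.factorial k) ≤ 2 ^ M)
    (ℓ : ℕ → ℕ)
    (h : ∀ n, k ≤ n → ∀ j ∈ Nkm k M, n ≡ j [MOD 2 ^ M] → ∀ m, M ≤ m →
      (¬ ConstMod (2 ^ (m - bk k + ℓ j + 1)) (Scls k n m)) ∧
      ConstMod (2 ^ (m - bk k + ℓ j)) (Scls k n m)) :
    ∀ m, M ≤ m →
      (Nkm k m).ncard = (Nkm k M).ncard ∧
      (∀ n, k ≤ n → ¬ ValConstOn k (cls n (2 ^ m)) →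
        Xor' (¬ ValConstOn k (cls n (2 ^ (m + 1))))
          (¬ ValConstOn k (cls (n + 2 ^ m) (2 ^ (m + 1))))) := by
  have hb : ∀ m, M ≤ m → ∀ n, k ≤ n → ¬ ValConstOn k (cls n (2 ^ m)) →
      Xor (¬ ValConstOn k (cls n (2 ^ (m + 1))))
        (¬ ValConstOn k (cls (n + 2 ^ m) (2 ^ (m + 1)))) := by
    intro m hm n hn hv
    obtain ⟨j, hj, hnj⟩ := exists_mem_Nkm_modEq hm hn hv
    have hpos : ∀ n' m', n ≤ n' → ∀ a ∈ cls n' (2 ^ m'), stirling2 a k ≠ 0 :=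
      fun n' m' hn' a ha => (stirling2_pos (by omega)
        ((hn.trans hn').trans ((le_max_left _ _).trans ha.1))).ne'
    have hmod : ∀ i, M ≤ i → n + 2 ^ i ≡ j [MOD 2 ^ M] := fun i hi =>
      ((add_two_pow_modEq n i).of_dvd (pow_dvd_pow 2 hi)).trans hnj
    obtain ⟨p₁, p₂⟩ := h n hn j hj hnj m hm
    obtain ⟨q₁, q₂⟩ := h n hn j hj hnj (m + 1) (by omega)
    obtain ⟨r₁, r₂⟩ := h (n + 2 ^ m) (Nat.le_add_right_of_le hn) j hj (hmod m hm) (m + 1) (by omega)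
    obtain ⟨s₁, -⟩ := h (n + 2 ^ (m + 1)) (Nat.le_add_right_of_le hn) j hj (hmod (m + 1) (by omega)) m hm
    rw [show m + 1 - bk k + ℓ j = m - bk k + ℓ j + 1 by omega] at q₁ q₂ r₁ r₂
    rw [not_valConstOn_iff (hpos n m le_rfl) p₂ p₁] at hv
    rw [not_valConstOn_iff (hpos n (m + 1) le_rfl) q₂ q₁,
      not_valConstOn_iff (hpos (n + 2 ^ m) (m + 1) (Nat.le_add_right _ _)) r₂ r₁]
    by_contra hx
    rw [xor_iff_not_iff, not_not] at hx
    apply s₁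
    set c := m - bk k + ℓ j
    have hdvd : ∀ a ∈ cls (n + 2 ^ (m + 1)) (2 ^ m), 2 ^ c ∣ stirling2 a k := fun a ha =>
      hv a (cls_subset_cls le_rfl (Nat.le_add_right _ _)
        ((add_two_pow_modEq n (m + 1)).of_dvd (pow_dvd_pow 2 m.le_succ)) ha)
    have hall : ∀ {A : Set ℕ}, ConstMod (2 ^ (c + 1)) ((fun j => stirling2 j k) '' A) →
        ∀ a ∈ A, 2 ^ (c + 1) ∣ stirling2 a k → ∀ b ∈ A, 2 ^ (c + 1) ∣ stirling2 b k :=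
      fun hA a ha hd b hb => ((hA _ ⟨a, ha, rfl⟩ _ ⟨b, hb, rfl⟩).dvd_iff dvd_rfl).1 hd
    have hiff : ∀ a ∈ cls (n + 2 ^ (m + 1)) (2 ^ m), (2 ^ (c + 1) ∣ stirling2 a k ↔
        ∀ b ∈ cls n (2 ^ (m + 1)), 2 ^ (c + 1) ∣ stirling2 b k) := by
      intro a ha
      rcases mem_children_of_mem_cls ha with ha | ha
      · exact ⟨hall q₂ a ha, fun hd => hd a ha⟩
      · exact ⟨fun hd => hx.2 (hall r₂ a ha hd), fun hd => hx.1 hd a ha⟩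
    rintro _ ⟨x, hxA, rfl⟩ _ ⟨y, hyA, rfl⟩
    have hxy := (hiff x hxA).trans (hiff y hyA).symm
    by_cases hd : 2 ^ (c + 1) ∣ stirling2 x k
    · exact (Nat.modEq_zero_iff_dvd.2 hd).trans (Nat.modEq_zero_iff_dvd.2 (hxy.1 hd)).symm
    · exact modEq_two_pow_succ_of_not_dvd (hdvd x hxA) (hdvd y hyA) hd (mt hxy.2 hd)
  refine fun m hm => ⟨?_, hb m hm⟩
  induction m, hm using Nat.le_induction with
  | base => rfl
  | succ m hm ih => exact (ncard_Nkm_succ (hb m hm)).trans ih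
end

section
/- Let k, ℓ, n be positive integers with k ≥ 5, and set s = ν₂(k!) + ℓ − b_k − 3 (assume s ≥ 0). Define f_k(n) = Σ_{i=1}^{⌈k/2⌉} C(k, 2i−1)·(2i−1)^n·((2i−1)^(2^(s+1)) − 1). Suppose m is an integer with m ≥ s+1 and 2^m − m ≥ s+3. If n ≥ 2^m, then S(n + 2^m, k) ≡ S(n, k) (mod 2^(m − b_k + ℓ)) if and only if f_k(n) ≡ 0 (mod 2^(2s+4)). -/
/-- The explicit formula for Stirling numbers of the second kind. -/
theorem alternating_sum_choose_mul_pow_eq_stirling2 (n k : ℕ) :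
    ∑ t ∈ Finset.range (k + 1), (-1 : ℤ) ^ t * (k.choose t : ℤ) * (t : ℤ) ^ n =
      (-1) ^ k * (k.factorial : ℤ) * (stirling2 n k : ℤ) := by
  induction n generalizing k with
  | zero =>
    cases k with
    | zero => simp [stirling2]
    | succ k => simp [stirling2, Int.alternating_sum_range_choose]
  | succ n ih =>
    cases k with
    | zero => simp [stirling2]
    | succ k =>
      have h1 := ih (k + 1)
      have h2 := ih k
      have h3 : ∑ t ∈ Finset.range (k + 1 + 1), (-1 : ℤ) ^ t * (k.choose t : ℤ) * (t : ℤ) ^ n =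
          (-1) ^ k * (k.factorial : ℤ) * (stirling2 n k : ℤ) := by
        rw [Finset.sum_range_succ, h2]
        simp
      have h4 : ∑ t ∈ Finset.range (k + 1 + 1),
          (-1 : ℤ) ^ t * ((k + 1).choose t : ℤ) * (t : ℤ) ^ (n + 1) =
          (k + 1) * ∑ t ∈ Finset.range (k + 1 + 1),
            (-1 : ℤ) ^ t * ((k + 1).choose t : ℤ) * (t : ℤ) ^ n -
          (k + 1) * ∑ t ∈ Finset.range (k + 1 + 1),
            (-1 : ℤ) ^ t * (k.choose t : ℤ) * (t : ℤ) ^ n := by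
        rw [Finset.mul_sum, Finset.mul_sum, ← Finset.sum_sub_distrib]
        refine Finset.sum_congr rfl fun t ht => ?_
        have ht' : t ≤ k + 1 := by
          have := Finset.mem_range.mp ht
          omega
        have h5 : (k.choose t : ℤ) * (k + 1) = ((k + 1).choose t : ℤ) * (k + 1 - t) := by
          have := congrArg (Nat.cast : ℕ → ℤ) (Nat.choose_mul_succ_eq k t)
          push_cast [Nat.cast_sub ht'] at this
          exact this
        linear_combination (-1 : ℤ) ^ t * (t : ℤ) ^ n * h5
      rw [h4, h1, h3, stirling2, Nat.factorial_succ]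
      push_cast
      ring

theorem two_pow_dvd_odd_pow_two_pow_sub_one {x : ℤ} (hx : Odd x) {j : ℕ} (hj : 1 ≤ j) :
    (2 : ℤ) ^ (j + 2) ∣ x ^ 2 ^ j - 1 := by
  induction j, hj using Nat.le_induction with
  | base => simpa using Int.eight_dvd_sq_sub_one_of_odd hx
  | succ j hj ih =>
    have h2 : (2 : ℤ) ∣ x ^ 2 ^ j + 1 := (hx.pow.add_odd odd_one).two_dvd
    have h : x ^ 2 ^ (j + 1) - 1 = (x ^ 2 ^ j - 1) * (x ^ 2 ^ j + 1) := by
      rw [pow_succ, pow_mul]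
      ring
    rw [h, add_right_comm, pow_succ]
    exact mul_dvd_mul ih h2

/-- The `2`-divisibility of `∑ c x * (x ^ 2 ^ j - 1)`, relative to `2 ^ j`, does not depend on the
choice of the large exponent `j`. -/
theorem two_pow_dvd_sum_odd_pow_sub_one_iff {ι : Type*} (A : Finset ι) (c x : ι → ℤ)
    (hx : ∀ i ∈ A, Odd (x i)) {r j : ℕ} (hrj : r + 1 ≤ j) :
    (2 : ℤ) ^ (j + r + 3) ∣ ∑ i ∈ A, c i * (x i ^ 2 ^ j - 1) ↔
      (2 : ℤ) ^ (2 * r + 4) ∣ ∑ i ∈ A, c i * (x i ^ 2 ^ (r + 1) - 1) := by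
  induction j, hrj using Nat.le_induction with
  | base => rw [show r + 1 + r + 3 = 2 * r + 4 by ring]
  | succ j hj ih =>
    rw [← ih]
    have h1 : ∑ i ∈ A, c i * (x i ^ 2 ^ (j + 1) - 1) =
        ∑ i ∈ A, c i * (x i ^ 2 ^ j - 1) ^ 2 + 2 * ∑ i ∈ A, c i * (x i ^ 2 ^ j - 1) := by
      rw [Finset.mul_sum, ← Finset.sum_add_distrib]
      refine Finset.sum_congr rfl fun i _ => ?_
      ring
    have h2 : (2 : ℤ) ^ (j + 1 + r + 3) ∣ ∑ i ∈ A, c i * (x i ^ 2 ^ j - 1) ^ 2 := by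
      refine Finset.dvd_sum fun i hi => Dvd.dvd.mul_left ?_ _
      have h3 := pow_dvd_pow_of_dvd
        (two_pow_dvd_odd_pow_two_pow_sub_one (hx i hi) (j := j) (by omega)) 2
      rw [← pow_mul] at h3
      exact (pow_dvd_pow 2 (by omega)).trans h3
    rw [h1, dvd_add_right h2, show j + 1 + r + 3 = (j + r + 3) + 1 by ring, pow_succ',
      mul_dvd_mul_iff_left two_ne_zero]

theorem two_pow_add_padicValNat_dvd_mul_iff {N : ℕ} (hN : N ≠ 0) (a : ℕ) (z : ℤ) :
    (2 : ℤ) ^ (a + padicValNat 2 N) ∣ N * z ↔ (2 : ℤ) ^ a ∣ z := by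
  set v := padicValNat 2 N with hv
  obtain ⟨q, hq⟩ : 2 ^ v ∣ N := pow_padicValNat_dvd
  have hq2 : ¬ 2 ∣ q := fun ⟨r, hr⟩ =>
    pow_succ_padicValNat_not_dvd (p := 2) hN ⟨r, by rw [← hv, pow_succ, mul_assoc, ← hr, ← hq]⟩
  have hcop : IsCoprime ((2 : ℤ) ^ a) (q : ℤ) :=
    (Nat.isCoprime_iff_coprime.2 ((Nat.prime_two.coprime_iff_not_dvd).2 hq2)).pow_left
  have hN' : (N : ℤ) = 2 ^ v * q := by exact_mod_cast hq
  rw [hN', add_comm, pow_add, mul_assoc, mul_dvd_mul_iff_left (by positivity)]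
  exact ⟨hcop.dvd_of_dvd_mul_left, fun h => h.mul_left _⟩

theorem two_pow_le_padicValNat_factorial_add_one (c : ℕ) :
    2 ^ c ≤ padicValNat 2 (2 ^ c).factorial + 1 := by
  induction c with
  | zero => simp
  | succ c ih =>
    rw [pow_succ', padicValNat_factorial_mul]
    omega

/-- The number `2 ^ (b_k + 1)` is smaller than `k`. -/
theorem two_pow_bk_add_one_lt {k : ℕ} (hk : 5 ≤ k) : 2 ^ (bk k + 1) < k := by
  have h : 3 ≤ Nat.clog 2 k := by
    have : 2 < Nat.clog 2 k := (Nat.lt_clog_iff_pow_lt (by norm_num)).2 (by omega)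
    omega
  refine (Nat.lt_clog_iff_pow_lt (by norm_num)).1 ?_
  unfold bk
  omega

theorem two_mul_bk_add_one_le_padicValNat_factorial {k : ℕ} (hk : 5 ≤ k) :
    2 * bk k + 1 ≤ padicValNat 2 k.factorial := by
  have h1 := (two_pow_bk_add_one_lt hk).le
  have h2 : 2 * bk k + 1 ≤ 2 ^ (bk k + 1) - 1 := by
    have : bk k < 2 ^ bk k := Nat.lt_two_pow_self
    rw [pow_succ]
    omega
  have h3 : padicValNat 2 (2 ^ (bk k + 1)).factorial ≤ padicValNat 2 k.factorial :=
    (padicValNat_dvd_iff_le k.factorial_ne_zero).1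
      (pow_padicValNat_dvd.trans (Nat.factorial_dvd_factorial h1))
  have h4 := two_pow_le_padicValNat_factorial_add_one (bk k + 1)
  omega

theorem sum_odd_add_sum_even {k : ℕ} (g : ℕ → ℤ) :
    ∑ t ∈ Finset.range (k + 1), g t =
      ∑ i ∈ Finset.Icc 1 ((k + 1) / 2), g (2 * i - 1) +
        ∑ i ∈ Finset.range (k / 2 + 1), g (2 * i) := by
  induction k with
  | zero => simp
  | succ k ih =>
    rw [Finset.sum_range_succ, ih]
    rcases Nat.even_or_odd' k with ⟨c, rfl | rfl⟩
    · rw [show (2 * c + 1 + 1) / 2 = c + 1 by omega, show (2 * c + 1) / 2 = c by omega,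
        show 2 * c / 2 = c by omega, Finset.sum_Icc_succ_top (by omega),
        show 2 * (c + 1) - 1 = 2 * c + 1 by omega]
      ring
    · rw [show (2 * c + 1 + 1 + 1) / 2 = c + 1 by omega, show (2 * c + 1 + 1) / 2 = c + 1 by omega,
        show (2 * c + 1) / 2 = c by omega, Finset.sum_range_succ _ (c + 1)]
      simp only [mul_add, mul_one, add_assoc, one_add_one_eq_two]

theorem f_St_correspondence (k ℓ n s m : ℕ) (hk : 5 ≤ k) (hℓ : 0 < ℓ) (hn : 0 < n)
    (hs : s + bk k + 3 = padicValNat 2 (Nat.factorial k) + ℓ)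
    (hm : s + 1 ≤ m) (hm2 : s + 3 ≤ 2 ^ m - m) (hn2m : 2 ^ m ≤ n) :
    stirling2 (n + 2 ^ m) k ≡ stirling2 n k [MOD 2 ^ (m - bk k + ℓ)] ↔
      (∑ i ∈ Finset.Icc 1 ((k + 1) / 2),
          Nat.choose k (2 * i - 1) * (2 * i - 1) ^ n *
            ((2 * i - 1) ^ (2 ^ (s + 1)) - 1)) ≡ 0 [MOD 2 ^ (2 * s + 4)] := by
  have hv := two_mul_bk_add_one_le_padicValNat_factorial hk
  have hsum := sum_odd_add_sum_even (k := k)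
    fun t => (-1 : ℤ) ^ t * (k.choose t : ℤ) * (t : ℤ) ^ (n + 2 ^ m) -
      (-1 : ℤ) ^ t * (k.choose t : ℤ) * (t : ℤ) ^ n
  rw [Finset.sum_sub_distrib, alternating_sum_choose_mul_pow_eq_stirling2,
    alternating_sum_choose_mul_pow_eq_stirling2] at hsum
  have hodd : ∑ i ∈ Finset.Icc 1 ((k + 1) / 2),
      ((-1 : ℤ) ^ (2 * i - 1) * (k.choose (2 * i - 1) : ℤ) * ((2 * i - 1 : ℕ) : ℤ) ^ (n + 2 ^ m) -
        (-1 : ℤ) ^ (2 * i - 1) * (k.choose (2 * i - 1) : ℤ) * ((2 * i - 1 : ℕ) : ℤ) ^ n) =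
      -∑ i ∈ Finset.Icc 1 ((k + 1) / 2),
        (k.choose (2 * i - 1) : ℤ) * ((2 * i - 1 : ℕ) : ℤ) ^ n *
          (((2 * i - 1 : ℕ) : ℤ) ^ 2 ^ m - 1) := by
    rw [← Finset.sum_neg_distrib]
    refine Finset.sum_congr rfl fun i hi => ?_
    have hi1 := (Finset.mem_Icc.mp hi).1
    rw [Odd.neg_one_pow ⟨i - 1, by omega⟩]
    ring
  have heven : (2 : ℤ) ^ (m + s + 3) ∣ ∑ i ∈ Finset.range (k / 2 + 1),
      ((-1 : ℤ) ^ (2 * i) * (k.choose (2 * i) : ℤ) * ((2 * i : ℕ) : ℤ) ^ (n + 2 ^ m) -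
        (-1 : ℤ) ^ (2 * i) * (k.choose (2 * i) : ℤ) * ((2 * i : ℕ) : ℤ) ^ n) := by
    have h2 : ∀ i e : ℕ, n ≤ e → (2 : ℤ) ^ (m + s + 3) ∣ ((2 * i : ℕ) : ℤ) ^ e := fun i e he => by
      refine (pow_dvd_pow 2 (by omega)).trans (pow_dvd_pow_of_dvd (?_ : (2 : ℤ) ∣ _) e)
      push_cast
      exact dvd_mul_right _ _
    exact Finset.dvd_sum fun i _ =>
      dvd_sub ((h2 i _ (by omega)).mul_left _) ((h2 i _ le_rfl).mul_left _)
  have hcast : ((∑ i ∈ Finset.Icc 1 ((k + 1) / 2),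
      Nat.choose k (2 * i - 1) * (2 * i - 1) ^ n * ((2 * i - 1) ^ (2 ^ (s + 1)) - 1) : ℕ) : ℤ) =
      ∑ i ∈ Finset.Icc 1 ((k + 1) / 2), (k.choose (2 * i - 1) : ℤ) * ((2 * i - 1 : ℕ) : ℤ) ^ n *
        (((2 * i - 1 : ℕ) : ℤ) ^ 2 ^ (s + 1) - 1) := by
    rw [Nat.cast_sum]
    refine Finset.sum_congr rfl fun i hi => ?_
    have hi1 := (Finset.mem_Icc.mp hi).1
    have h3 : 1 ≤ (2 * i - 1) ^ 2 ^ (s + 1) := Nat.one_le_pow _ _ (by omega)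
    rw [Nat.cast_mul, Nat.cast_sub h3]
    push_cast
    rfl
  have hx : ∀ i ∈ Finset.Icc 1 ((k + 1) / 2), Odd (((2 * i - 1 : ℕ) : ℤ)) := fun i hi => by
    have hi1 := (Finset.mem_Icc.mp hi).1
    exact (Int.odd_coe_nat _).2 ⟨i - 1, by omega⟩
  rw [Nat.ModEq.comm, Nat.modEq_iff_dvd, Nat.modEq_zero_iff_dvd, ← Int.natCast_dvd_natCast, hcast]
  push_cast [-Nat.cast_sum]
  rw [← two_pow_dvd_sum_odd_pow_sub_one_iff _ _ _ hx hm,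
    ← two_pow_add_padicValNat_dvd_mul_iff k.factorial_ne_zero,
    show m - bk k + ℓ + padicValNat 2 k.factorial = m + s + 3 by omega,
    ← dvd_neg (b := ∑ i ∈ _, _), ← hodd, eq_sub_of_add_eq hsum.symm,
    dvd_sub_left heven, mul_assoc, mul_assoc, ← mul_sub, ← mul_sub,
    (isUnit_one.neg.pow k).dvd_mul_left]
end

section
/- For every integer m ≥ 3 and every integer n ≥ 5, the set S([n]_{2^m}, 5) = { S(j,5) : j ∈ [n]_{2^m} } is constant modulo 2^(m−1) but is not constant modulo 2^m. -/
theorem stirling2_succ_one (n : ℕ) : stirling2 (n + 1) 1 = 1 := by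
  induction n with
  | zero => rfl
  | succ n ih =>
    have h : stirling2 (n + 2) 1 = 1 * stirling2 (n + 1) 1 + stirling2 (n + 1) 0 := rfl
    rw [h, ih]
    rfl

theorem two_mul_stirling2_succ_two (n : ℕ) :
    2 * (stirling2 (n + 1) 2 : ℤ) = 2 ^ (n + 1) - 2 := by
  induction n with
  | zero => rfl
  | succ n ih =>
    have h : stirling2 (n + 2) 2 = 2 * stirling2 (n + 1) 2 + stirling2 (n + 1) 1 := rfl
    rw [h, stirling2_succ_one]
    push_cast
    linear_combination 2 * ih

theorem six_mul_stirling2_succ_three (n : ℕ) :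
    6 * (stirling2 (n + 1) 3 : ℤ) = 3 ^ (n + 1) - 3 * 2 ^ (n + 1) + 3 := by
  induction n with
  | zero => rfl
  | succ n ih =>
    have h : stirling2 (n + 2) 3 = 3 * stirling2 (n + 1) 3 + stirling2 (n + 1) 2 := rfl
    rw [h]
    push_cast
    linear_combination 3 * ih + 3 * two_mul_stirling2_succ_two n

theorem twentyfour_mul_stirling2_succ_four (n : ℕ) :
    24 * (stirling2 (n + 1) 4 : ℤ) =
      4 ^ (n + 1) - 4 * 3 ^ (n + 1) + 6 * 2 ^ (n + 1) - 4 := by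
  induction n with
  | zero => rfl
  | succ n ih =>
    have h : stirling2 (n + 2) 4 = 4 * stirling2 (n + 1) 4 + stirling2 (n + 1) 3 := rfl
    rw [h]
    push_cast
    linear_combination 4 * ih + 4 * six_mul_stirling2_succ_three n

theorem onetwenty_mul_stirling2_succ_five (n : ℕ) :
    120 * (stirling2 (n + 1) 5 : ℤ) =
      5 ^ (n + 1) - 5 * 4 ^ (n + 1) + 10 * 3 ^ (n + 1) - 10 * 2 ^ (n + 1) + 5 := by
  induction n with
  | zero => rfl
  | succ n ih =>
    have h : stirling2 (n + 2) 5 = 5 * stirling2 (n + 1) 5 + stirling2 (n + 1) 4 := rfl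
    rw [h]
    push_cast
    linear_combination 5 * ih + 5 * twentyfour_mul_stirling2_succ_four n

theorem five_pow_two_pow (m : ℕ) :
    ∃ u : ℤ, (5 : ℤ) ^ 2 ^ m = 1 + 2 ^ (m + 2) * (2 * u + 1) := by
  induction m with
  | zero => exact ⟨0, by norm_num⟩
  | succ m ih =>
    obtain ⟨u, hu⟩ := ih
    refine ⟨u + 2 ^ m * (2 * u + 1) ^ 2, ?_⟩
    rw [pow_succ 2 m, pow_mul, hu]
    ring

theorem three_pow_two_pow_succ (m : ℕ) :
    ∃ v : ℤ, (3 : ℤ) ^ 2 ^ (m + 1) = 1 + 2 ^ (m + 3) * v := by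
  induction m with
  | zero => exact ⟨1, by norm_num⟩
  | succ m ih =>
    obtain ⟨v, hv⟩ := ih
    refine ⟨v + 2 ^ (m + 2) * v ^ 2, ?_⟩
    rw [pow_succ 2 (m + 1), pow_mul, hv]
    ring

theorem stirling2_five_add_two_pow (p j : ℕ) (hp : 2 ≤ p) (hj : 2 ^ (p + 1) ≤ j) :
    (2 : ℤ) ^ (p + 1) ∣ stirling2 (j + 2 ^ (p + 1)) 5 - stirling2 j 5 - 2 ^ p := by
  obtain ⟨u, hu⟩ := five_pow_two_pow (p + 1)
  obtain ⟨v, hv⟩ := three_pow_two_pow_succ p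
  obtain ⟨w, hw⟩ : Odd ((5 : ℤ) ^ j) := Odd.pow (by decide)
  have hle : p + 3 ≤ 2 ^ (p + 1) := by
    have h : p + 1 ≤ 2 ^ p := Nat.lt_two_pow_self
    rw [pow_succ]
    omega
  obtain ⟨i, rfl⟩ : ∃ i, j = i + 1 := ⟨j - 1, by omega⟩
  obtain ⟨t, ht⟩ : ∃ t, i + 1 = p + 3 + t := ⟨i + 1 - (p + 3), by omega⟩
  set N := 2 ^ (p + 1)
  have h₁ := onetwenty_mul_stirling2_succ_five i
  have h₂ := onetwenty_mul_stirling2_succ_five (i + N)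
  rw [show i + N + 1 = i + 1 + N by ring, pow_add 5 (i + 1), pow_add 4 (i + 1),
    pow_add 3 (i + 1), pow_add 2 (i + 1), hu, hv] at h₂
  have e₂ : (2 : ℤ) ^ (i + 1) = 8 * 2 ^ p * 2 ^ t := by rw [ht]; ring
  have e₄ : (4 : ℤ) ^ (i + 1) = 8 * 2 ^ p * 2 ^ t * 2 ^ (i + 1) := by
    rw [← e₂, ← mul_pow]; norm_num
  refine IsCoprime.dvd_of_dvd_mul_left (show IsCoprime _ (15 : ℤ) from IsCoprime.pow_left (by norm_num)) ?_
  refine ⟨2 * u * w + u + w - 7 + 5 * 3 ^ (i + 1) * v - 5 * 2 ^ t * (2 ^ N - 1)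
    - 5 * 2 ^ t * 2 ^ i * (4 ^ N - 1), mul_left_cancel₀ (show (8 : ℤ) ≠ 0 by norm_num) ?_⟩
  linear_combination h₂ - h₁ + 2 ^ (p + 3) * (2 * u + 1) * hw - 5 * (4 ^ N - 1) * e₄
    - 10 * (2 ^ N - 1) * e₂

theorem stirling2_five_modEq (m j : ℕ) (hm : 3 ≤ m) (hj : 2 ^ m ≤ j) :
    stirling2 (j + 2 ^ m) 5 ≡ stirling2 j 5 + 2 ^ (m - 1) [MOD 2 ^ m] := by
  obtain ⟨p, rfl⟩ : ∃ p, m = p + 1 := ⟨m - 1, by omega⟩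
  have h := stirling2_five_add_two_pow p j (by omega) hj
  refine (Nat.modEq_iff_dvd.2 ?_).symm
  push_cast
  rw [← sub_sub]
  exact h

theorem stirling2_five_modEq_of_modEq (m j k : ℕ) (hm : 3 ≤ m) (hj : 2 ^ m ≤ j) :
    stirling2 (j + 2 ^ m * k) 5 ≡ stirling2 j 5 [MOD 2 ^ (m - 1)] := by
  induction k with
  | zero => rfl
  | succ k ih =>
    have h := (stirling2_five_modEq m (j + 2 ^ m * k) hm (by omega)).of_dvd
      (pow_dvd_pow 2 (Nat.sub_le m 1))
    rw [Nat.mul_succ, ← Nat.add_assoc]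
    exact h.trans (Nat.add_modEq_right.trans ih)

theorem k5_const_levels (m n : ℕ) (hm : 3 ≤ m) (hn : 5 ≤ n) :
    ConstMod (2 ^ (m - 1)) (Scls 5 n m) ∧ ¬ ConstMod (2 ^ m) (Scls 5 n m) := by
  constructor
  · rintro _ ⟨a, ⟨ha, ha'⟩, rfl⟩ _ ⟨b, ⟨hb, hb'⟩, rfl⟩
    wlog hab : a ≤ b generalizing a b
    · exact (this b hb hb' a ha ha' (by omega)).symm
    obtain ⟨k, hk⟩ := (Nat.modEq_iff_dvd' hab).1 (ha'.trans hb'.symm)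
    obtain rfl : b = a + 2 ^ m * k := by omega
    exact (stirling2_five_modEq_of_modEq m a k hm ((le_max_right _ _).trans ha)).symm
  · intro h
    have mem : ∀ k, 1 ≤ k → n + 2 ^ m * k ∈ cls n (2 ^ m) := fun k hk =>
      ⟨max_le (by omega) ((Nat.le_mul_of_pos_right _ hk).trans (by omega)),
        by simp [Nat.ModEq]⟩
    have h₁ := h _ ⟨_, mem 2 (by norm_num), rfl⟩ _ ⟨_, mem 1 le_rfl, rfl⟩
    have h₂ := stirling2_five_modEq m (n + 2 ^ m * 1) hm (by omega)
    rw [show n + 2 ^ m * 1 + 2 ^ m = n + 2 ^ m * 2 by ring] at h₂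
    have h₃ : 0 ≡ 2 ^ (m - 1) [MOD 2 ^ m] :=
      Nat.ModEq.add_left_cancel' _ (h₁.symm.trans h₂)
    have h₄ := Nat.le_of_dvd (by positivity) ((Nat.modEq_zero_iff_dvd).1 h₃.symm)
    exact absurd h₄ (not_le.2 (Nat.pow_lt_pow_right (by norm_num) (by omega)))
end

section
/- For every integer m ≥ 3 and every integer n ≥ 7, the set S([n]_{2^m}, 7) = { S(j,7) : j ∈ [n]_{2^m} } is not constant modulo 2^m if and only if n is odd. -/
theorem two_mul_stirling2_two (n : ℕ) :
    (2 * stirling2 (n + 1) 2 : ℤ) = 2 ^ (n + 1) - 2 := by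
  induction n with
  | zero => simp [stirling2]
  | succ n ih =>
    rw [stirling2, stirling2_succ_one]
    push_cast
    linear_combination 2 * ih

theorem six_mul_stirling2_three (n : ℕ) :
    (6 * stirling2 (n + 1) 3 : ℤ) = 3 ^ (n + 1) - 3 * 2 ^ (n + 1) + 3 := by
  induction n with
  | zero => simp [stirling2]
  | succ n ih =>
    rw [stirling2]
    push_cast
    linear_combination 3 * ih + 3 * two_mul_stirling2_two n

theorem twentyfour_mul_stirling2_four (n : ℕ) :
    (24 * stirling2 (n + 1) 4 : ℤ) =
      4 ^ (n + 1) - 4 * 3 ^ (n + 1) + 6 * 2 ^ (n + 1) - 4 := by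
  induction n with
  | zero => simp [stirling2]
  | succ n ih =>
    rw [stirling2]
    push_cast
    linear_combination 4 * ih + 4 * six_mul_stirling2_three n

theorem onehundredtwenty_mul_stirling2_five (n : ℕ) :
    (120 * stirling2 (n + 1) 5 : ℤ) =
      5 ^ (n + 1) - 5 * 4 ^ (n + 1) + 10 * 3 ^ (n + 1) - 10 * 2 ^ (n + 1) + 5 := by
  induction n with
  | zero => simp [stirling2]
  | succ n ih =>
    rw [stirling2]
    push_cast
    linear_combination 5 * ih + 5 * twentyfour_mul_stirling2_four n

theorem sevenhundredtwenty_mul_stirling2_six (n : ℕ) :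
    (720 * stirling2 (n + 1) 6 : ℤ) =
      6 ^ (n + 1) - 6 * 5 ^ (n + 1) + 15 * 4 ^ (n + 1) - 20 * 3 ^ (n + 1)
        + 15 * 2 ^ (n + 1) - 6 := by
  induction n with
  | zero => simp [stirling2]
  | succ n ih =>
    rw [stirling2]
    push_cast
    linear_combination 6 * ih + 6 * onehundredtwenty_mul_stirling2_five n

theorem factorial_seven_mul_stirling2_seven (n : ℕ) (hn : n ≠ 0) :
    (5040 * stirling2 n 7 : ℤ) =
      7 ^ n - 7 * 6 ^ n + 21 * 5 ^ n - 35 * 4 ^ n + 35 * 3 ^ n - 21 * 2 ^ n + 7 := by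
  obtain ⟨n, rfl⟩ := Nat.exists_eq_succ_of_ne_zero hn
  rw [Nat.succ_eq_add_one]
  clear hn
  induction n with
  | zero => simp [stirling2]
  | succ n ih =>
    rw [stirling2]
    push_cast
    linear_combination 7 * ih + 7 * sevenhundredtwenty_mul_stirling2_six n

theorem exists_three_pow_two_pow (r : ℕ) :
    ∃ k : ℤ, 3 ^ 2 ^ (r + 1) = 1 + 4 * 2 ^ (r + 1) + 16 * 2 ^ (r + 1) * k := by
  induction r with
  | zero => exact ⟨0, by norm_num⟩
  | succ r ih =>
    obtain ⟨k, hk⟩ := ih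
    refine ⟨k + 2 ^ r * (1 + 4 * k) ^ 2, ?_⟩
    rw [pow_succ 2 (r + 1), pow_mul, hk]
    ring

theorem exists_five_pow_two_pow (r : ℕ) :
    ∃ k : ℤ, 5 ^ 2 ^ (r + 1) = 1 + 12 * 2 ^ (r + 1) + 16 * 2 ^ (r + 1) * k := by
  induction r with
  | zero => exact ⟨0, by norm_num⟩
  | succ r ih =>
    obtain ⟨k, hk⟩ := ih
    refine ⟨k + 2 ^ r * (3 + 4 * k) ^ 2, ?_⟩
    rw [pow_succ 2 (r + 1), pow_mul, hk]
    ring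

theorem exists_seven_pow_two_pow (r : ℕ) :
    ∃ k : ℤ, 7 ^ 2 ^ (r + 1) = 1 + 8 * 2 ^ (r + 1) + 16 * 2 ^ (r + 1) * k := by
  induction r with
  | zero => exact ⟨1, by norm_num⟩
  | succ r ih =>
    obtain ⟨k, hk⟩ := ih
    refine ⟨k + 2 ^ r * (2 + 4 * k) ^ 2, ?_⟩
    rw [pow_succ 2 (r + 1), pow_mul, hk]
    ring

theorem add_four_le_two_pow {m : ℕ} (hm : 3 ≤ m) : m + 4 ≤ 2 ^ m := by
  induction m, hm using Nat.le_induction with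
  | base => norm_num
  | succ m _ ih => rw [pow_succ]; omega

theorem two_pow_dvd_mul_two_pow {m j : ℕ} (hm : 3 ≤ m) (hj : 2 ^ m ≤ j) (a : ℤ) :
    16 * 2 ^ m ∣ (2 * a) ^ j := by
  have h : (16 * 2 ^ m : ℤ) = 2 ^ (m + 4) := by ring
  rw [h, mul_pow]
  exact Dvd.dvd.mul_right (pow_dvd_pow 2 ((add_four_le_two_pow hm).trans hj)) _

/-- Along a step of length `2 ^ m`, the change of `7! * S(·, 7)` modulo `2 ^ (m + 4)`
is governed by the powers of the odd bases. -/
theorem exists_stirling2_seven_step {m j : ℕ} (hm : 3 ≤ m) (hj : 2 ^ m ≤ j) :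
    ∃ x : ℤ, (5040 * (stirling2 (j + 2 ^ m) 7 - stirling2 j 7) : ℤ) =
      4 * 2 ^ m * (2 * 7 ^ j + 63 * 5 ^ j + 35 * 3 ^ j) + 16 * 2 ^ m * x := by
  have hpos : 0 < 2 ^ m := by positivity
  obtain ⟨a, ha⟩ := two_pow_dvd_mul_two_pow hm hj 1
  obtain ⟨b, hb⟩ := two_pow_dvd_mul_two_pow hm hj 2
  obtain ⟨c, hc⟩ := two_pow_dvd_mul_two_pow hm hj 3
  norm_num at ha hb hc
  have h1 := factorial_seven_mul_stirling2_seven (j + 2 ^ m) (by omega)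
  have h0 := factorial_seven_mul_stirling2_seven j (by omega)
  obtain ⟨r, rfl⟩ : ∃ r, m = r + 1 := ⟨m - 1, by omega⟩
  obtain ⟨k₃, h₃⟩ := exists_three_pow_two_pow r
  obtain ⟨k₅, h₅⟩ := exists_five_pow_two_pow r
  obtain ⟨k₇, h₇⟩ := exists_seven_pow_two_pow r
  rw [pow_add 7, pow_add 6, pow_add 5, pow_add 4, pow_add 3, pow_add 2 j,
    h₃, h₅, h₇, ha, hb, hc] at h1
  rw [ha, hb, hc] at h0
  refine ⟨7 ^ j * k₇ + 21 * 5 ^ j * k₅ + 35 * 3 ^ j * k₃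
    - 7 * c * (6 ^ 2 ^ (r + 1) - 1) - 35 * b * (4 ^ 2 ^ (r + 1) - 1)
    - 21 * a * (2 ^ 2 ^ (r + 1) - 1), ?_⟩
  linear_combination h1 - h0

theorem stirling2_seven_step_of_even {m j : ℕ} (hm : 3 ≤ m) (hj : 2 ^ m ≤ j) (he : Even j) :
    (2 ^ m : ℤ) ∣ stirling2 (j + 2 ^ m) 7 - stirling2 j 7 := by
  obtain ⟨x, hx⟩ := exists_stirling2_seven_step hm hj
  have h : (4 : ℤ) ∣ 2 * 7 ^ j + 63 * 5 ^ j + 35 * 3 ^ j := by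
    obtain ⟨i, rfl⟩ := he
    have h₇ : (7 ^ 2 : ℤ) ^ i ≡ 1 ^ i [ZMOD 4] := Int.ModEq.pow i (by decide)
    have h₅ : (5 ^ 2 : ℤ) ^ i ≡ 1 ^ i [ZMOD 4] := Int.ModEq.pow i (by decide)
    have h₃ : (3 ^ 2 : ℤ) ^ i ≡ 1 ^ i [ZMOD 4] := Int.ModEq.pow i (by decide)
    rw [← two_mul, pow_mul, pow_mul, pow_mul]
    simp only [Int.ModEq, one_pow] at h₇ h₅ h₃
    omega
  obtain ⟨y, hy⟩ := h
  have hcop : IsCoprime (2 ^ m : ℤ) 315 := IsCoprime.pow_left ⟨158, -1, by norm_num⟩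
  refine hcop.dvd_of_dvd_mul_left ⟨y + x, ?_⟩
  rw [hy] at hx
  linarith

theorem stirling2_seven_step_of_odd {m j : ℕ} (hm : 3 ≤ m) (hj : 2 ^ m ≤ j) (ho : Odd j) :
    ¬ (2 ^ m : ℤ) ∣ stirling2 (j + 2 ^ m) 7 - stirling2 j 7 := by
  rintro ⟨z, hz⟩
  obtain ⟨x, hx⟩ := exists_stirling2_seven_step hm hj
  have h : (2 * 7 ^ j + 63 * 5 ^ j + 35 * 3 ^ j : ℤ) % 4 = 2 := by
    obtain ⟨i, rfl⟩ := ho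
    have h₇ : (7 ^ 2 : ℤ) ^ i ≡ 1 ^ i [ZMOD 4] := Int.ModEq.pow i (by decide)
    have h₅ : (5 ^ 2 : ℤ) ^ i ≡ 1 ^ i [ZMOD 4] := Int.ModEq.pow i (by decide)
    have h₃ : (3 ^ 2 : ℤ) ^ i ≡ 1 ^ i [ZMOD 4] := Int.ModEq.pow i (by decide)
    rw [pow_succ, pow_succ, pow_succ, pow_mul, pow_mul, pow_mul]
    simp only [Int.ModEq, one_pow] at h₇ h₅ h₃
    omega
  have h' : (4 * 2 ^ m : ℤ) * (1260 * z) =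
      4 * 2 ^ m * ((2 * 7 ^ j + 63 * 5 ^ j + 35 * 3 ^ j) + 4 * x) := by
    rw [hz] at hx
    linear_combination hx
  have := mul_left_cancel₀ (by positivity) h'
  omega

theorem stirling2_seven_modEq_of_even {m j : ℕ} (hm : 3 ≤ m) (hj : 2 ^ m ≤ j) (he : Even j)
    (c : ℕ) : stirling2 j 7 ≡ stirling2 (j + 2 ^ m * c) 7 [MOD 2 ^ m] := by
  induction c with
  | zero => rfl
  | succ c ih =>
    refine ih.trans ?_
    rw [Nat.modEq_iff_dvd, mul_add, mul_one, ← add_assoc]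
    push_cast
    refine stirling2_seven_step_of_even hm (by omega) (he.add ?_)
    exact (Even.pow_of_ne_zero even_two (by omega)).mul_right c

theorem even_of_mem_cls {m n j : ℕ} (hm : 3 ≤ m) (hj : j ∈ cls n (2 ^ m)) (hn : Even n) :
    Even j := by
  have h : j ≡ n [MOD 2] := hj.2.of_dvd (dvd_pow_self 2 (by omega))
  rw [Nat.even_iff] at hn ⊢
  rwa [h]

theorem k7_nonconst_m (m n : ℕ) (hm : 3 ≤ m) (hn : 7 ≤ n) :
    ¬ ConstMod (2 ^ m) (Scls 7 n m) ↔ Odd n := by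
  constructor
  · contrapose!
    rw [Nat.not_odd_iff_even]
    intro he
    have key : ∀ a ∈ cls n (2 ^ m), ∀ b ∈ cls n (2 ^ m), a ≤ b →
        stirling2 a 7 ≡ stirling2 b 7 [MOD 2 ^ m] := by
      intro a ha b hb hab
      obtain ⟨c, hc⟩ := (Nat.modEq_iff_dvd' hab).1 (ha.2.trans hb.2.symm)
      obtain rfl : b = a + 2 ^ m * c := by omega
      exact stirling2_seven_modEq_of_even hm ((le_max_right _ _).trans ha.1)
        (even_of_mem_cls hm ha he) c
    rintro _ ⟨a, ha, rfl⟩ _ ⟨b, hb, rfl⟩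
    rcases le_total a b with hab | hab
    · exact key a ha b hb hab
    · exact (key b hb a ha hab).symm
  · intro ho h
    have hpos : 0 < 2 ^ m := by positivity
    have ha : n + 2 ^ m ∈ cls n (2 ^ m) :=
      ⟨max_le (by omega) (by omega), by simp [Nat.ModEq]⟩
    have hb : n + 2 ^ m + 2 ^ m ∈ cls n (2 ^ m) :=
      ⟨max_le (by omega) (by omega), by simp [Nat.ModEq]⟩
    have h' := h _ ⟨_, ha, rfl⟩ _ ⟨_, hb, rfl⟩
    rw [Nat.modEq_iff_dvd] at h'
    push_cast at h'
    exact stirling2_seven_step_of_odd hm (by omega)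
      (ho.add_even (Even.pow_of_ne_zero even_two (by omega))) h'
end

section
/- For every integer m ≥ 4 and every integer n ≥ 7, the set S([n]_{2^m}, 7) = { S(j,7) : j ∈ [n]_{2^m} } is not constant modulo 2^(m+2). -/
/-- The explicit formulas for `k! * S(n, k)` with `1 ≤ k ≤ 7` and `n` positive. -/
lemma factorial_mul_stirling2_formulas (n : ℕ) :
    (stirling2 (n + 1) 1 : ℤ) = 1 ∧
    2 * (stirling2 (n + 1) 2 : ℤ) = 2 ^ (n + 1) - 2 ∧
    6 * (stirling2 (n + 1) 3 : ℤ) = 3 ^ (n + 1) - 3 * 2 ^ (n + 1) + 3 ∧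
    24 * (stirling2 (n + 1) 4 : ℤ) = 4 ^ (n + 1) - 4 * 3 ^ (n + 1) + 6 * 2 ^ (n + 1) - 4 ∧
    120 * (stirling2 (n + 1) 5 : ℤ) =
      5 ^ (n + 1) - 5 * 4 ^ (n + 1) + 10 * 3 ^ (n + 1) - 10 * 2 ^ (n + 1) + 5 ∧
    720 * (stirling2 (n + 1) 6 : ℤ) =
      6 ^ (n + 1) - 6 * 5 ^ (n + 1) + 15 * 4 ^ (n + 1) - 20 * 3 ^ (n + 1)
        + 15 * 2 ^ (n + 1) - 6 ∧
    5040 * (stirling2 (n + 1) 7 : ℤ) =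
      7 ^ (n + 1) - 7 * 6 ^ (n + 1) + 21 * 5 ^ (n + 1) - 35 * 4 ^ (n + 1)
        + 35 * 3 ^ (n + 1) - 21 * 2 ^ (n + 1) + 7 := by
  induction n with
  | zero => simp [stirling2]
  | succ n ih =>
    obtain ⟨h1, h2, h3, h4, h5, h6, h7⟩ := ih
    have h0 : stirling2 (n + 1) 0 = 0 := rfl
    have hrec (k : ℕ) : (stirling2 (n + 1 + 1) (k + 1) : ℤ) =
        (k + 1) * stirling2 (n + 1) (k + 1) + stirling2 (n + 1) k := by
      rw [stirling2]
      push_cast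
      ring
    have r1 := hrec 0
    have r2 := hrec 1
    have r3 := hrec 2
    have r4 := hrec 3
    have r5 := hrec 4
    have r6 := hrec 5
    have r7 := hrec 6
    norm_num [h0] at r1 r2 r3 r4 r5 r6 r7
    simp only [pow_succ _ (n + 1)]
    refine ⟨?_, ?_, ?_, ?_, ?_, ?_, ?_⟩ <;> linarith

/-- If `x ^ 16 = 1 + 64 * c` modulo `1024`, then `x ^ 2 ^ m = 1 + 2 ^ (m + 2) * c`
modulo `2 ^ (m + 6)` for all `m ≥ 4`. -/
lemma exists_pow_two_pow_eq {x c : ℤ} (h : ∃ v, x ^ 16 = 1 + 64 * (c + 16 * v))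
    {m : ℕ} (hm : 4 ≤ m) :
    ∃ v, x ^ 2 ^ m = 1 + 2 ^ (m + 2) * (c + 16 * v) := by
  induction m, hm using Nat.le_induction with
  | base => simpa using h
  | succ m hm ih =>
    obtain ⟨v, hv⟩ := ih
    obtain ⟨r, rfl⟩ := Nat.exists_eq_add_of_le hm
    refine ⟨v + 2 ^ (r + 1) * (c + 16 * v) ^ 2, ?_⟩
    rw [pow_succ 2, pow_mul, hv]
    ring

/-- The residue of `7! * (S(j + 2 ^ m, 7) - S(j, 7)) / 2 ^ (m + 2)` modulo `16`, for large `j`, is nonzero. -/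
lemma not_sixteen_dvd_pow_combination (j : ℕ) :
    ¬ (16 : ℤ) ∣ 7 ^ j * 6 + 21 * 5 ^ j * 15 + 35 * 3 ^ j * 13 := by
  have h (x : ℤ) (hx : (x ^ 4) ≡ 1 [ZMOD 16]) : x ^ j ≡ x ^ (j % 4) [ZMOD 16] := by
    conv_lhs => rw [← Nat.div_add_mod j 4, pow_add, pow_mul]
    simpa using (hx.pow (j / 4)).mul_right (x ^ (j % 4))
  have h7 := h 7 (by decide)
  have h5 := h 5 (by decide)
  have h3 := h 3 (by decide)
  have hj : j % 4 < 4 := Nat.mod_lt _ (by norm_num)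
  unfold Int.ModEq at h7 h5 h3
  interval_cases j % 4 <;> omega

theorem k7_nonconst_m2 (m n : ℕ) (hm : 4 ≤ m) (hn : 7 ≤ n) :
    ¬ ConstMod (2 ^ (m + 2)) (Scls 7 n m) := by
  intro hconst
  have hlt : m < 2 ^ m := Nat.lt_two_pow_self
  have hmem (i : ℕ) (hi : 1 ≤ i) :
      stirling2 (n + i * 2 ^ m) 7 ∈ Scls 7 n m := by
    refine ⟨n + i * 2 ^ m, ⟨?_, by simp [Nat.ModEq]⟩, rfl⟩
    have := Nat.mul_le_mul_right (2 ^ m) hi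
    omega
  have hcong := (Nat.modEq_iff_dvd.mp (hconst _ (hmem 1 le_rfl) _ (hmem 2 one_le_two)))
  obtain ⟨s, hs⟩ : ∃ s, n + 1 * 2 ^ m = m + 6 + s + 1 :=
    Nat.exists_eq_add_of_le (show m + 6 + 1 ≤ n + 1 * 2 ^ m by omega) |>.imp fun _ h => by omega
  have hs' : n + 2 * 2 ^ m = m + 6 + s + 2 ^ m + 1 := by omega
  rw [hs, hs'] at hcong
  obtain ⟨q, hq⟩ := hcong
  have f0 := (factorial_mul_stirling2_formulas (m + 6 + s)).2.2.2.2.2.2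
  have f1 := (factorial_mul_stirling2_formulas (m + 6 + s + 2 ^ m)).2.2.2.2.2.2
  obtain ⟨v3, h3⟩ := exists_pow_two_pow_eq (x := 3) (c := 13) ⟨42037, by norm_num⟩ hm
  obtain ⟨v5, h5⟩ := exists_pow_two_pow_eq (x := 5) (c := 15) ⟨149011611, by norm_num⟩ hm
  obtain ⟨v7, h7⟩ := exists_pow_two_pow_eq (x := 7) (c := 6) ⟨32454033759, by norm_num⟩ hm
  have hdvd (x : ℤ) (hx : 2 ∣ x) (t : ℕ) (ht : m + 6 ≤ t) : (2 : ℤ) ^ (m + 6) ∣ x ^ t :=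
    (pow_dvd_pow_of_dvd hx _).trans (pow_dvd_pow _ ht)
  have heven (x : ℤ) (hx : 2 ∣ x) :
      ∃ w, x ^ (m + 6 + s + 2 ^ m + 1) - x ^ (m + 6 + s + 1) = 2 ^ (m + 2) * (16 * w) := by
    obtain ⟨w, hw⟩ := dvd_sub (hdvd x hx (m + 6 + s + 2 ^ m + 1) (by omega))
      (hdvd x hx (m + 6 + s + 1) (by omega))
    exact ⟨w, by rw [hw]; ring⟩
  obtain ⟨w2, e2⟩ := heven 2 (by norm_num)
  obtain ⟨w4, e4⟩ := heven 4 (by norm_num)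
  obtain ⟨w6, e6⟩ := heven 6 (by norm_num)
  have hsplit (x : ℤ) : x ^ (m + 6 + s + 2 ^ m + 1) = x ^ (m + 6 + s + 1) * x ^ 2 ^ m := by
    rw [← pow_add]
    congr 1
    ring
  have o3 := hsplit 3
  have o5 := hsplit 5
  have o7 := hsplit 7
  rw [h3] at o3
  rw [h5] at o5
  rw [h7] at o7
  apply not_sixteen_dvd_pow_combination (m + 6 + s + 1)
  refine ⟨315 * q + 7 * w6 + 35 * w4 + 21 * w2 - 7 ^ (m + 6 + s + 1) * v7
    - 21 * 5 ^ (m + 6 + s + 1) * v5 - 35 * 3 ^ (m + 6 + s + 1) * v3, ?_⟩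
  apply mul_left_cancel₀ (pow_ne_zero (m + 2) (two_ne_zero : (2 : ℤ) ≠ 0))
  push_cast at hq
  linear_combination 5040 * hq - f1 + f0 - o7 - 21 * o5 - 35 * o3 + 7 * e6 + 35 * e4 + 21 * e2
end
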